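/- Suppose the commutative noetherian complete Cohen-Macaulay local ring R with canonical module is an R-order (equivalently, the canonical module of R is locally free on the punctured spectrum). If R has strongly unbounded lattice type, then so does the power series ring R[[t]]. -/

import Mathlib

universe u

open IsLocalRing

noncomputable section

namespace BT

/-- The length of a module, defined as the Krull dimension of its lattice of
submodules (which agrees with the usual composition-series length). -/
def moduleLength (A : Type u) [Ring A] (M : Type u) [AddCommGroup M] [Module A M] :
    WithBot ℕ∞ :=
  Order.krullDim (Submodule A M)

/-- `M` is a maximal Cohen-Macaulay module over the local ring `R`: it admits an
`M`-regular sequence contained in the maximal ideal whose length is `dim R`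
(i.e. `depth_R M = dim R`). -/
def IsMCM (R : Type u) [CommRing R] [IsLocalRing R]
    (M : Type u) [AddCommGroup M] [Module R M] : Prop :=
  ∃ rs : List R, (∀ r ∈ rs, r ∈ maximalIdeal R) ∧ RingTheory.Sequence.IsRegular M rs ∧
    (rs.length : WithBot ℕ∞) = ringKrullDim R

/-- The `n`-th Ext group of two `R`-modules. -/
def extGroup (R : Type u) [CommRing R] (n : ℕ)
    (A B : Type u) [AddCommGroup A] [Module R A] [AddCommGroup B] [Module R B] : Type u :=
  ((Ext R (ModuleCat.{u} R) n).obj (Opposite.op (ModuleCat.of R A))).obj (ModuleCat.of R B)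

instance (R : Type u) [CommRing R] (n : ℕ)
    (A B : Type u) [AddCommGroup A] [Module R A] [AddCommGroup B] [Module R B] :
    AddCommGroup (extGroup R n A B) :=
  inferInstanceAs (AddCommGroup
    (((Ext R (ModuleCat.{u} R) n).obj (Opposite.op (ModuleCat.of R A))).obj (ModuleCat.of R B)))

instance (R : Type u) [CommRing R] (n : ℕ)
    (A B : Type u) [AddCommGroup A] [Module R A] [AddCommGroup B] [Module R B] :
    Module R (extGroup R n A B) :=
  inferInstanceAs (Module R
    (((Ext R (ModuleCat.{u} R) n).obj (Opposite.op (ModuleCat.of R A))).obj (ModuleCat.of R B)))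

/-- `ω` is a canonical module for the Cohen-Macaulay local ring `R`: it is a
finitely generated module with `Ext^i_R(k, ω) = 0` for `i ≠ dim R` and
`Ext^{dim R}_R(k, ω) ≅ k`. -/
def IsCanonicalModule (R : Type u) [CommRing R] [IsLocalRing R]
    (ω : Type u) [AddCommGroup ω] [Module R ω] : Prop :=
  Module.Finite R ω ∧ ∃ d : ℕ, (d : WithBot ℕ∞) = ringKrullDim R ∧
    (∀ i : ℕ, i ≠ d → Subsingleton (extGroup R i (ResidueField R) ω)) ∧
    Nonempty (extGroup R d (ResidueField R) ω ≃ₗ[R] ResidueField R)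

/-- A homomorphism of `Λ`-modules factors through a projective `Λ`-module. -/
def FactorsThroughProjective (Λ : Type u) [Ring Λ] {M N : Type u}
    [AddCommGroup M] [Module Λ M] [AddCommGroup N] [Module Λ N] (f : M →ₗ[Λ] N) : Prop :=
  ∃ (P : Type u) (_ : AddCommGroup P) (_ : Module Λ P), Module.Projective Λ P ∧
    ∃ (g : M →ₗ[Λ] P) (h : P →ₗ[Λ] N), h.comp g = f

section StableHom

variable (R : Type u) [CommRing R] (Λ : Type u) [Ring Λ] [Algebra R Λ]
variable (M N : Type u) [AddCommGroup M] [Module Λ M]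
  [AddCommGroup N] [Module Λ N] [Module R N] [IsScalarTower R Λ N]

/-- The `R`-submodule of `Hom_Λ(M, N)` consisting of the homomorphisms that
factor through a projective `Λ`-module. -/
def projTrivial : Submodule R (M →ₗ[Λ] N) where
  carrier := {f | FactorsThroughProjective Λ f}
  zero_mem' := ⟨Λ, inferInstance, inferInstance, inferInstance, 0, 0, by ext; simp⟩
  add_mem' := by
    rintro f₁ f₂ ⟨P₁, _, _, hP₁, g₁, h₁, rfl⟩ ⟨P₂, _, _, hP₂, g₂, h₂, rfl⟩
    exact ⟨P₁ × P₂, inferInstance, inferInstance, inferInstance,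
      g₁.prod g₂, h₁.comp (LinearMap.fst Λ P₁ P₂) + h₂.comp (LinearMap.snd Λ P₁ P₂),
      by ext m; simp⟩
  smul_mem' := by
    rintro r f ⟨P, _, _, hP, g, h, rfl⟩
    exact ⟨P, inferInstance, inferInstance, hP, g, r • h, by ext m; simp⟩

/-- The stable Hom `Hom-bar_Λ(M, N)`: homomorphisms modulo those factoring
through projectives, as an `R`-module. -/
def stableHom : Type u := (M →ₗ[Λ] N) ⧸ projTrivial R Λ M N

instance : AddCommGroup (stableHom R Λ M N) :=
  inferInstanceAs (AddCommGroup ((M →ₗ[Λ] N) ⧸ projTrivial R Λ M N))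

instance : Module R (stableHom R Λ M N) :=
  inferInstanceAs (Module R ((M →ₗ[Λ] N) ⧸ projTrivial R Λ M N))

end StableHom

/-- The `h`-length of `M` (relative to a fixed module `G`): the length over `R`
of `h(M) = Hom-bar_Λ(M, M ⊕ G)`. -/
def hLength (R : Type u) [CommRing R] (Λ : Type u) [Ring Λ] [Algebra R Λ]
    (M : Type u) [AddCommGroup M] [Module Λ M] [Module R M] [IsScalarTower R Λ M]
    (G : Type u) [AddCommGroup G] [Module Λ G] [Module R G] [IsScalarTower R Λ G] :
    WithBot ℕ∞ :=
  moduleLength R (stableHom R Λ M (M × G))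

/-- A module is indecomposable if it is nonzero and admits no nontrivial direct
sum decomposition. -/
def IsIndecomposable (Λ : Type u) [Ring Λ] (M : Type u) [AddCommGroup M] [Module Λ M] : Prop :=
  Nontrivial M ∧ ∀ A B : Submodule Λ M, IsCompl A B → A = ⊥ ∨ B = ⊥

/-- `Ext¹_Λ(M, Y) = 0`, expressed by the splitting of extensions: every
surjection onto `M` with kernel isomorphic to `Y` splits. -/
def Ext1Vanishes (Λ : Type u) [Ring Λ] (M Y : Type u)
    [AddCommGroup M] [Module Λ M] [AddCommGroup Y] [Module Λ Y] : Prop :=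
  ∀ (E : Type u) (_ : AddCommGroup E) (_ : Module Λ E) (g : E →ₗ[Λ] M),
    Function.Surjective g → Nonempty ((LinearMap.ker g) ≃ₗ[Λ] Y) →
      ∃ s : M →ₗ[Λ] E, g.comp s = LinearMap.id

/-- A homomorphism `f : X → C` is right minimal if every endomorphism `g` of `X`
with `f ∘ g = f` is an isomorphism. -/
def RightMinimal (Λ : Type u) [Ring Λ] {X C : Type u} [AddCommGroup X] [Module Λ X]
    [AddCommGroup C] [Module Λ C] (f : X →ₗ[Λ] C) : Prop :=
  ∀ g : X →ₗ[Λ] X, f.comp g = f → Function.Bijective g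

/-- `M` is an `R`-lattice over the commutative local ring `R`: a finitely
generated maximal Cohen-Macaulay module that is free on the punctured
spectrum of `R`. -/
def IsLatticeC (R : Type u) [CommRing R] [IsLocalRing R]
    (M : Type u) [AddCommGroup M] [Module R M] : Prop :=
  Module.Finite R M ∧ IsMCM R M ∧
    ∀ (p : Ideal R) [p.IsPrime], p ≠ maximalIdeal R →
      Module.Free (Localization.AtPrime p) (LocalizedModule p.primeCompl M)

/-- The `h`-length of an `R`-module `M` (relative to `G`): the length over `R`
of `Hom-bar_R(M, M ⊕ G)`. -/
def hLengthC (R : Type u) [CommRing R] (M : Type u) [AddCommGroup M] [Module R M]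
    (G : Type u) [AddCommGroup G] [Module R G] : WithBot ℕ∞ :=
  hLength R R M G

/-- `Y` is a lat-injective `R`-module: a lattice with `Ext¹_R(M, Y) = 0` for
every `R`-lattice `M`. -/
def IsLatInjectiveC (R : Type u) [CommRing R] [IsLocalRing R]
    (Y : Type u) [AddCommGroup Y] [Module R Y] : Prop :=
  IsLatticeC R Y ∧ ∀ (M : Type u) (_ : AddCommGroup M) (_ : Module R M),
    IsLatticeC R M → Ext1Vanishes R M Y

/-- `Y` admits a finite resolution `0 → L_t → ⋯ → L_0 → Y → 0` by lat-injective
`R`-modules. -/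
def HasLatInjResOfLengthC (R : Type u) [CommRing R] [IsLocalRing R] :
    ℕ → ∀ (Y : Type u) [AddCommGroup Y] [Module R Y], Prop
  | 0, Y, _, _ => IsLatInjectiveC R Y
  | (t + 1), Y, _, _ =>
      ∃ (L : Type u) (_ : AddCommGroup L) (_ : Module R L) (π : L →ₗ[R] Y),
        IsLatInjectiveC R L ∧ Function.Surjective π ∧
          HasLatInjResOfLengthC R t (LinearMap.ker π)

/-- `α : X → C` is a minimal lat-approximation of the `R`-module `C`. -/
def IsMinimalLatApproxC (R : Type u) [CommRing R] [IsLocalRing R]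
    {X : Type u} [AddCommGroup X] [Module R X]
    {C : Type u} [AddCommGroup C] [Module R C] (α : X →ₗ[R] C) : Prop :=
  IsLatticeC R X ∧ Function.Surjective α ∧
    (∃ t : ℕ, HasLatInjResOfLengthC R t (LinearMap.ker α)) ∧ RightMinimal R α

/-- `α : G → k` is a minimal lat-approximation of the residue field of `R`. -/
def IsResidueApprox (R : Type u) [CommRing R] [IsLocalRing R]
    (G : Type u) [AddCommGroup G] [Module R G] (α : G →ₗ[R] ResidueField R) : Prop :=
  IsMinimalLatApproxC R α

/-- There are infinitely many pairwise non-isomorphic indecomposable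
`R`-lattices of `h`-length `t`. -/
def InfManyIndecLatticesOfHLengthC (R : Type u) [CommRing R] [IsLocalRing R]
    (G : Type u) [AddCommGroup G] [Module R G] (t : ℕ) : Prop :=
  ∃ (F : ℕ → Type u) (_ : ∀ n, AddCommGroup (F n)) (_ : ∀ n, Module R (F n)),
    (∀ n, IsLatticeC R (F n) ∧ IsIndecomposable R (F n) ∧
      hLengthC R (F n) G = (t : WithBot ℕ∞)) ∧
    ∀ m n : ℕ, m ≠ n → IsEmpty (F m ≃ₗ[R] F n)

/-- `R` has strongly unbounded lattice type. -/
def StronglyUnboundedLatTypeC (R : Type u) [CommRing R] [IsLocalRing R]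
    (G : Type u) [AddCommGroup G] [Module R G] : Prop :=
  ∃ b : ℕ → ℕ, StrictMono b ∧ ∀ i, InfManyIndecLatticesOfHLengthC R G (b i)

/-- `R` is of finite lattice type: there are only finitely many isomorphism
classes of indecomposable `R`-lattices. -/
def FiniteLatTypeC (R : Type u) [CommRing R] [IsLocalRing R] : Prop :=
  ∃ (n : ℕ) (F : Fin n → Type u) (_ : ∀ i, AddCommGroup (F i)) (_ : ∀ i, Module R (F i)),
    ∀ (M : Type u) (_ : AddCommGroup M) (_ : Module R M),
      IsLatticeC R M → IsIndecomposable R M → ∃ i, Nonempty (M ≃ₗ[R] F i)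

/-- `R` is of bounded lattice type: there is `b > 0` with `ℓ(h(M)) < b` for
every indecomposable `R`-lattice `M`. -/
def BoundedLatTypeC (R : Type u) [CommRing R] [IsLocalRing R]
    (G : Type u) [AddCommGroup G] [Module R G] : Prop :=
  ∃ b : ℕ, 0 < b ∧ ∀ (M : Type u) (_ : AddCommGroup M) (_ : Module R M),
    IsLatticeC R M → IsIndecomposable R M → hLengthC R M G < (b : WithBot ℕ∞)

section Lengths

variable {S : Type u} [CommRing S] [IsLocalRing S]

theorem smul_eq_zero_of_mem_pow_of_length_le (b : ℕ) {X : Type u} [AddCommGroup X] [Module S X]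
    (h : Module.length S X ≤ b) {y : S} (hy : y ∈ maximalIdeal S ^ b) (x : X) : y • x = 0 := by
  suffices H : ∀ (b : ℕ) (N : Submodule S X), Module.length S N ≤ b →
      maximalIdeal S ^ b • N = ⊥ by
    have h1 := H b ⊤ (by rwa [Module.length_top])
    have h2 : y • x ∈ maximalIdeal S ^ b • (⊤ : Submodule S X) :=
      Submodule.smul_mem_smul hy Submodule.mem_top
    rwa [h1, Submodule.mem_bot] at h2
  clear hy x h y b
  intro b
  induction b with
  | zero =>
    intro N hN
    have : Subsingleton N := by
      rw [← Module.length_eq_zero_iff (R := S)]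
      exact le_antisymm (by simpa using hN) zero_le
    rw [(Submodule.subsingleton_iff_eq_bot).mp this]
    simp
  | succ b ih =>
    intro N hN
    have hfl : IsFiniteLength S N := by
      rw [← Module.length_ne_top_iff]
      exact ne_top_of_le_ne_top (ENat.natCast_ne_top (b + 1)) hN
    obtain ⟨hn, ha⟩ := isFiniteLength_iff_isNoetherian_isArtinian.mp hfl
    by_cases hbot : N = ⊥
    · rw [hbot]; simp
    have hfg : N.FG := by
      have : Module.Finite S N := inferInstance
      exact Module.Finite.iff_fg.mp this
    have hlt : maximalIdeal S • N < N := by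
      refine lt_of_le_of_ne Submodule.smul_le_right ?_
      intro heq
      exact hbot (Submodule.eq_bot_of_le_smul_of_le_jacobson_bot (maximalIdeal S) N hfg
        heq.ge (maximalIdeal_le_jacobson _))
    have hlen : Module.length S ↥(maximalIdeal S • N) < Module.length S N := by
      have hne : (maximalIdeal S • N).submoduleOf N ≠ ⊤ := by
        intro h
        rw [Submodule.submoduleOf_eq_top] at h
        exact absurd h (not_le_of_gt hlt)
      have := Submodule.length_lt hne
      rwa [(Submodule.submoduleOfEquivOfLe hlt.le).length_eq] at this
    have := ih (maximalIdeal S • N) (by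
      have h1 := hlen.trans_le hN
      push_cast at h1
      exact Order.le_of_lt_add_one h1)
    rw [pow_succ, Submodule.mul_smul, this]

theorem exists_minimal_cover (Z : Type u) [AddCommGroup Z] [Module S Z] [Module.Finite S Z] :
    ∃ (n : ℕ) (f : (Fin n → S) →ₗ[S] Z), Function.Surjective f ∧
      LinearMap.ker f ≤ maximalIdeal S • ⊤ := by
  let k := ResidueField S
  let b := Module.finBasis k (TensorProduct S k Z)
  have hsurj : Function.Surjective (TensorProduct.mk S k Z 1) :=
    TensorProduct.mk_surjective _ _ _ Ideal.Quotient.mk_surjective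
  choose z hz using fun i => hsurj (b i)
  refine ⟨_, Fintype.linearCombination S z, ?_, ?_⟩
  · rw [← LinearMap.range_eq_top, Fintype.range_linearCombination]
    exact IsLocalRing.span_eq_top_of_tmul_eq_basis z b hz
  · intro w hw
    rw [LinearMap.mem_ker, Fintype.linearCombination_apply] at hw
    have h1 : ∑ i, (residue S (w i)) • b i = 0 := by
      have := congrArg (TensorProduct.mk S k Z 1) hw
      rw [map_sum, map_zero] at this
      rw [← this]
      refine Finset.sum_congr rfl fun i _ => ?_
      rw [map_smul, hz]
      exact algebraMap_smul k (w i) (b i)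
    have h2 := Fintype.linearIndependent_iff.mp b.linearIndependent _ h1
    rw [pi_eq_sum_univ w]
    refine Submodule.sum_mem _ fun i _ => Submodule.smul_mem_smul ?_ Submodule.mem_top
    rw [← residue_eq_zero_iff]
    exact h2 i

variable {Z : Type u} [AddCommGroup Z] [Module S Z] {n : ℕ} {f : (Fin n → S) →ₗ[S] Z}

theorem exists_residue_coordinates (hf : Function.Surjective f)
    (hk : LinearMap.ker f ≤ maximalIdeal S • ⊤) :
    ∃ θ : Z →ₗ[S] (Fin n → ResidueField S), ∀ w, θ (f w) = fun i => residue S (w i) := by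
  let r : (Fin n → S) →ₗ[S] (Fin n → ResidueField S) :=
    LinearMap.pi fun i => (Algebra.linearMap S (ResidueField S)).comp (LinearMap.proj i)
  have hr : LinearMap.ker f ≤ LinearMap.ker r := by
    refine hk.trans (Submodule.smul_le.mpr ?_)
    intro s hs w _
    rw [LinearMap.mem_ker]
    ext i
    simp [r, Algebra.smul_def]
    exact Or.inl hs
  refine ⟨((LinearMap.ker f).liftQ r hr).comp
    (f.quotKerEquivOfSurjective hf).symm.toLinearMap, fun w => ?_⟩
  have : (f.quotKerEquivOfSurjective hf).symm (f w) = Submodule.Quotient.mk w := by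
    rw [LinearEquiv.symm_apply_eq]; rfl
  rw [LinearMap.comp_apply, LinearEquiv.coe_coe, this]
  rfl

theorem length_residueField : Module.length S (ResidueField S) = 1 := by
  have : IsSimpleModule S (ResidueField S) :=
    isSimpleModule_iff_isCoatom.mpr (maximalIdeal.isMaximal S).out
  exact Module.length_eq_one _ _

theorem length_fin_residueField (n : ℕ) :
    Module.length S (Fin n → ResidueField S) = n := by
  simp [length_residueField]

theorem le_length_hom_residueField (hf : Function.Surjective f)
    (hk : LinearMap.ker f ≤ maximalIdeal S • ⊤) :
    (n : ℕ∞) ≤ Module.length S (Z →ₗ[S] ResidueField S) := by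
  obtain ⟨θ, hθ⟩ := exists_residue_coordinates hf hk
  let F : (Fin n → ResidueField S) →ₗ[S] (Z →ₗ[S] ResidueField S) :=
    { toFun := fun v => ∑ i, ((LinearMap.mulLeft S (v i)).comp (LinearMap.proj i)).comp θ
      map_add' := by
        intro v w
        ext z
        simp [add_mul, Finset.sum_add_distrib]
      map_smul' := by
        intro s w
        ext z
        simp [Finset.smul_sum] }
  rw [← length_fin_residueField (S := S) n]
  refine Module.length_le_of_injective F ?_
  rw [← LinearMap.ker_eq_bot, LinearMap.ker_eq_bot']
  intro v hv
  ext i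
  have := LinearMap.congr_fun hv (f (Pi.single i 1))
  simpa [F, hθ, Pi.single_apply, apply_ite] using this

theorem le_length_quotient (hf : Function.Surjective f)
    (hk : LinearMap.ker f ≤ maximalIdeal S • ⊤) :
    (n : ℕ∞) ≤ Module.length S (Z ⧸ (maximalIdeal S • (⊤ : Submodule S Z))) := by
  obtain ⟨θ, hθ⟩ := exists_residue_coordinates hf hk
  rw [← length_fin_residueField (S := S) n]
  have hle : maximalIdeal S • (⊤ : Submodule S Z) ≤ LinearMap.ker θ := by
    refine Submodule.smul_le.mpr fun s hs z _ => ?_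
    obtain ⟨w, rfl⟩ := hf z
    have : residue S s = 0 := (residue_eq_zero_iff s).mpr hs
    rw [LinearMap.mem_ker, ← map_smul, hθ]
    ext i
    simp [this]
  refine Module.length_le_of_surjective (Submodule.liftQ _ θ hle) ?_
  intro v
  choose w hw using fun i => IsLocalRing.residue_surjective (v i)
  refine ⟨Submodule.Quotient.mk (f w), ?_⟩
  rw [Submodule.liftQ_apply, hθ]
  ext i
  simp [hw]

end Lengths

section Covers

variable {S : Type u} [CommRing S] {Z : Type u} [AddCommGroup Z] [Module S Z] {n : ℕ}
  {f : (Fin n → S) →ₗ[S] Z}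

theorem length_hom_le (hf : Function.Surjective f) (X : Type u) [AddCommGroup X] [Module S X] :
    Module.length S (Z →ₗ[S] X) ≤ n * Module.length S X := by
  let F : (Z →ₗ[S] X) →ₗ[S] (Fin n → X) :=
    LinearMap.pi fun i => LinearMap.applyₗ (f (Pi.single i 1))
  have : Module.length S (Fin n → X) = n * Module.length S X := by simp
  rw [← this]
  refine Module.length_le_of_injective F ?_
  rw [← LinearMap.ker_eq_bot, LinearMap.ker_eq_bot']
  intro g hg
  have : g.comp f = 0 := by
    apply LinearMap.pi_ext'
    intro i
    ext
    exact congrFun hg i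
  ext z
  obtain ⟨w, rfl⟩ := hf z
  exact LinearMap.congr_fun this w

theorem exists_surjective_of_le {m : ℕ} (hf : Function.Surjective f) (h : n ≤ m) :
    ∃ g : (Fin m → S) →ₗ[S] Z, Function.Surjective g := by
  refine ⟨f.comp (LinearMap.funLeft S S (Fin.castLE h)), hf.comp ?_⟩
  exact LinearMap.funLeft_surjective_of_injective S S _ (Fin.castLE_injective h)

end Covers

namespace FactorsThroughProjective

variable {S : Type u} [CommRing S] {X Y Z : Type u} [AddCommGroup X] [Module S X]
  [AddCommGroup Y] [Module S Y] [AddCommGroup Z] [Module S Z]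

theorem add {f g : X →ₗ[S] Y} (hf : FactorsThroughProjective S f)
    (hg : FactorsThroughProjective S g) : FactorsThroughProjective S (f + g) :=
  (projTrivial S S X Y).add_mem hf hg

theorem smul {f : X →ₗ[S] Y} (s : S) (hf : FactorsThroughProjective S f) :
    FactorsThroughProjective S (s • f) :=
  (projTrivial S S X Y).smul_mem s hf

theorem comp_left {f : X →ₗ[S] Y} (hf : FactorsThroughProjective S f) (g : Y →ₗ[S] Z) :
    FactorsThroughProjective S (g.comp f) := by
  obtain ⟨P, _, _, hP, a, b, rfl⟩ := hf
  exact ⟨P, _, _, hP, a, g.comp b, rfl⟩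

theorem comp_right {f : Y →ₗ[S] Z} (hf : FactorsThroughProjective S f) (g : X →ₗ[S] Y) :
    FactorsThroughProjective S (f.comp g) := by
  obtain ⟨P, _, _, hP, a, b, rfl⟩ := hf
  exact ⟨P, _, _, hP, a.comp g, b, rfl⟩

theorem of_projective [Module.Projective S Y] (g : X →ₗ[S] Y) (h : Y →ₗ[S] Z) :
    FactorsThroughProjective S (h.comp g) :=
  ⟨Y, _, _, inferInstance, g, h, rfl⟩

theorem exists_lift {f : X →ₗ[S] Y} (hf : FactorsThroughProjective S f) {π : Z →ₗ[S] Y}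
    (hπ : Function.Surjective π) : ∃ s : X →ₗ[S] Z, π.comp s = f := by
  obtain ⟨P, _, _, hP, a, b, rfl⟩ := hf
  obtain ⟨l, hl⟩ := Module.projective_lifting_property π b hπ
  exact ⟨l.comp a, by rw [← LinearMap.comp_assoc, hl]⟩

end FactorsThroughProjective

/-- Multiplication by every element of `𝔪 ^ c` factors through a projective module. -/
def IsTame (S : Type u) [CommRing S] [IsLocalRing S] (c : ℕ) (Z : Type u) [AddCommGroup Z]
    [Module S Z] : Prop :=
  ∀ y ∈ maximalIdeal S ^ c, FactorsThroughProjective S (y • (LinearMap.id : Z →ₗ[S] Z))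

section StableHomLength

open scoped Pointwise

variable {S : Type u} [CommRing S]

theorem moduleLength_eq_length (X : Type u) [AddCommGroup X] [Module S X] :
    moduleLength S X = ((Module.length S X : ℕ∞) : WithBot ℕ∞) :=
  (Module.coe_length S X).symm

/-- The class of a homomorphism in the stable Hom module. -/
def stableHomMk (Z X : Type u) [AddCommGroup Z] [Module S Z] [AddCommGroup X] [Module S X] :
    (Z →ₗ[S] X) →ₗ[S] stableHom S S Z X :=
  (projTrivial S S Z X).mkQ

theorem stableHomMk_surjective (Z X : Type u) [AddCommGroup Z] [Module S Z] [AddCommGroup X]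
    [Module S X] : Function.Surjective (stableHomMk (S := S) Z X) :=
  (projTrivial S S Z X).mkQ_surjective

theorem stableHomMk_eq_zero_iff {Z X : Type u} [AddCommGroup Z] [Module S Z] [AddCommGroup X]
    [Module S X] {f : Z →ₗ[S] X} : stableHomMk Z X f = 0 ↔ FactorsThroughProjective S f :=
  Submodule.Quotient.mk_eq_zero (projTrivial S S Z X)

/-- The map induced on stable Hom modules by a linear map out of the Hom module that kills the
homomorphisms factoring through a projective. -/
def stableHomLift {Z X W : Type u} [AddCommGroup Z] [Module S Z] [AddCommGroup X] [Module S X]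
    [AddCommGroup W] [Module S W] (φ : (Z →ₗ[S] X) →ₗ[S] W)
    (hφ : ∀ f, FactorsThroughProjective S f → φ f = 0) : stableHom S S Z X →ₗ[S] W :=
  (projTrivial S S Z X).liftQ φ hφ

theorem stableHomLift_mk {Z X W : Type u} [AddCommGroup Z] [Module S Z] [AddCommGroup X]
    [Module S X] [AddCommGroup W] [Module S W] (φ : (Z →ₗ[S] X) →ₗ[S] W)
    (hφ : ∀ f, FactorsThroughProjective S f → φ f = 0) (f : Z →ₗ[S] X) :
    stableHomLift φ hφ (stableHomMk Z X f) = φ f :=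
  Submodule.liftQ_apply _ _ _

/-- Postcomposition on stable Hom modules. -/
def stableHomMap (Z : Type u) {X Y : Type u} [AddCommGroup Z] [Module S Z] [AddCommGroup X]
    [Module S X] [AddCommGroup Y] [Module S Y] (g : X →ₗ[S] Y) :
    stableHom S S Z X →ₗ[S] stableHom S S Z Y :=
  stableHomLift ((stableHomMk Z Y).comp (LinearMap.compRight S g))
    fun _ hf => stableHomMk_eq_zero_iff.mpr (hf.comp_left g)

theorem stableHomMap_mk {Z X Y : Type u} [AddCommGroup Z] [Module S Z] [AddCommGroup X]
    [Module S X] [AddCommGroup Y] [Module S Y] (g : X →ₗ[S] Y) (f : Z →ₗ[S] X) :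
    stableHomMap Z g (stableHomMk Z X f) = stableHomMk Z Y (g.comp f) :=
  stableHomLift_mk _ _ f

theorem length_le_mul_length_quotSMulTop (x : S) (c : ℕ) : ∀ (H : Type u) [AddCommGroup H]
    [Module S H], (∀ h : H, x ^ c • h = 0) →
      Module.length S H ≤ c * Module.length S (QuotSMulTop x H) := by
  induction c with
  | zero =>
    intro H _ _ hx
    have : Subsingleton H := ⟨fun a b => by simpa using (hx a).trans (hx b).symm⟩
    simp
  | succ c ih =>
    intro H _ _ hx
    let W : Submodule S H := x • ⊤
    have hW : ∀ w : W, x ^ c • w = 0 := by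
      rintro ⟨w, hw⟩
      obtain ⟨v, -, rfl⟩ := (Submodule.mem_smul_pointwise_iff_exists _ _ _).mp hw
      ext
      simpa [smul_smul, ← pow_succ] using hx v
    let g : H →ₗ[S] W := (LinearMap.lsmul S H x).codRestrict W
      fun v => Submodule.smul_mem_pointwise_smul v x ⊤ Submodule.mem_top
    have hg : Function.Surjective g := by
      rintro ⟨w, hw⟩
      obtain ⟨v, -, rfl⟩ := (Submodule.mem_smul_pointwise_iff_exists _ _ _).mp hw
      exact ⟨v, rfl⟩
    have h1 : Module.length S (QuotSMulTop x W) ≤ Module.length S (QuotSMulTop x H) :=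
      Module.length_le_of_surjective (QuotSMulTop.map x g) (QuotSMulTop.map_surjective x hg)
    have h2 := Module.length_eq_add_of_exact W.subtype W.mkQ W.subtype_injective
      W.mkQ_surjective (LinearMap.exact_subtype_mkQ W)
    rw [h2]
    push_cast
    rw [add_mul, one_mul]
    exact add_le_add ((ih W hW).trans (mul_le_mul_right h1 _)) le_rfl

theorem exists_smul_eq_of_range_le {Z X : Type u} [AddCommGroup Z] [Module S Z] [AddCommGroup X]
    [Module S X] {x : S} (hx : IsSMulRegular X x) (f : Z →ₗ[S] X)
    (hf : ∀ z, f z ∈ (x • ⊤ : Submodule S X)) : ∃ g : Z →ₗ[S] X, f = x • g := by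
  choose g hg using fun z => (Submodule.mem_smul_pointwise_iff_exists _ _ _).mp (hf z)
  refine ⟨{ toFun := g, map_add' := ?_, map_smul' := ?_ }, ?_⟩
  · intro a b
    apply hx
    simp only [smul_add, (hg _).2, map_add]
  · intro s a
    apply hx
    simp only [RingHom.id_apply]
    rw [smul_comm x s]
    simp only [(hg _).2, map_smul]
  · ext z
    exact (hg z).2.symm

theorem length_quotSMulTop_stableHom_le (Z X : Type u) [AddCommGroup Z] [Module S Z]
    [AddCommGroup X] [Module S X] {x : S} (hx : IsSMulRegular X x) :
    Module.length S (QuotSMulTop x (stableHom S S Z X)) ≤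
      Module.length S (stableHom S S Z (QuotSMulTop x X)) := by
  let q : X →ₗ[S] QuotSMulTop x X := (x • ⊤ : Submodule S X).mkQ
  have hle : (x • ⊤ : Submodule S (stableHom S S Z X)) ≤ LinearMap.ker (stableHomMap Z q) := by
    intro w hw
    obtain ⟨v, -, rfl⟩ := (Submodule.mem_smul_pointwise_iff_exists _ _ _).mp hw
    obtain ⟨f, rfl⟩ := stableHomMk_surjective _ _ v
    rw [LinearMap.mem_ker, ← map_smul, stableHomMap_mk]
    have : q.comp (x • f) = 0 := by
      ext z
      simp only [LinearMap.comp_apply, LinearMap.smul_apply, LinearMap.zero_apply, q]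
      rw [Submodule.mkQ_apply, Submodule.Quotient.mk_eq_zero]
      exact Submodule.smul_mem_pointwise_smul _ _ _ Submodule.mem_top
    rw [this, map_zero]
  refine Module.length_le_of_injective (Submodule.liftQ _ (stableHomMap Z q) hle) ?_
  rw [← LinearMap.ker_eq_bot, Submodule.ker_liftQ_eq_bot _ _ hle]
  intro w hw
  obtain ⟨f, rfl⟩ := stableHomMk_surjective _ _ w
  rw [LinearMap.mem_ker, stableHomMap_mk, stableHomMk_eq_zero_iff] at hw
  let π : (X →₀ S) →ₗ[S] X := Finsupp.linearCombination S id
  have hπ : Function.Surjective π := Finsupp.linearCombination_id_surjective S X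
  obtain ⟨s, hs⟩ := hw.exists_lift (π := q.comp π) ((Submodule.mkQ_surjective _).comp hπ)
  obtain ⟨g, hg⟩ := exists_smul_eq_of_range_le hx (f - π.comp s) (fun z => by
    have := LinearMap.congr_fun hs z
    rw [← Submodule.Quotient.mk_eq_zero, ← Submodule.mkQ_apply, LinearMap.sub_apply, map_sub]
    exact sub_eq_zero.mpr this.symm)
  have : stableHomMk Z X f = x • stableHomMk Z X g := by
    rw [← map_smul, ← hg, map_sub,
      stableHomMk_eq_zero_iff.mpr (FactorsThroughProjective.of_projective s π), sub_zero]
  rw [this]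
  exact Submodule.smul_mem_pointwise_smul _ _ _ Submodule.mem_top

theorem IsTame.smul_stableHom [IsLocalRing S] {c : ℕ} {Z : Type u} [AddCommGroup Z] [Module S Z]
    (hZ : IsTame S c Z) (X : Type u) [AddCommGroup X] [Module S X] {y : S}
    (hy : y ∈ maximalIdeal S ^ c) (h : stableHom S S Z X) : y • h = 0 := by
  obtain ⟨f, rfl⟩ := stableHomMk_surjective _ _ h
  rw [← map_smul, stableHomMk_eq_zero_iff]
  have := (hZ y hy).comp_left f
  rwa [LinearMap.comp_smul, LinearMap.comp_id] at this

theorem IsTame.of_length_le [IsLocalRing S] {b : ℕ} {Z : Type u} [AddCommGroup Z] [Module S Z]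
    (h : Module.length S (stableHom S S Z Z) ≤ b) : IsTame S b Z := by
  intro y hy
  rw [← stableHomMk_eq_zero_iff, map_smul]
  exact smul_eq_zero_of_mem_pow_of_length_le b h hy _

theorem length_stableHom_le [IsLocalRing S] {c n : ℕ} {Z : Type u} [AddCommGroup Z] [Module S Z]
    {f : (Fin n → S) →ₗ[S] Z} (hf : Function.Surjective f) (hZ : IsTame S c Z) (xs : List S)
    (hxs : ∀ x ∈ xs, x ∈ maximalIdeal S) : ∀ (X : Type u) [AddCommGroup X] [Module S X],
      RingTheory.Sequence.IsWeaklyRegular X xs → Module.length S (stableHom S S Z X) ≤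
        c ^ xs.length * (n * Module.length S (X ⧸ (Ideal.ofList xs • (⊤ : Submodule S X)))) := by
  induction xs with
  | nil =>
    intro X _ _ _
    have e : (X ⧸ (Ideal.ofList ([] : List S) • (⊤ : Submodule S X))) ≃ₗ[S] X :=
      Submodule.quotEquivOfEqBot _ (by rw [Ideal.ofList_nil, Submodule.bot_smul])
    rw [e.length_eq]
    simpa using (Module.length_le_of_surjective _ (stableHomMk_surjective Z X)).trans
      (length_hom_le hf X)
  | cons x xs ih =>
    intro X _ _ hX
    rw [RingTheory.Sequence.isWeaklyRegular_cons_iff] at hX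
    have h1 := length_le_mul_length_quotSMulTop x c (stableHom S S Z X)
      (fun h => hZ.smul_stableHom X (Ideal.pow_mem_pow (hxs x (by simp)) c) h)
    have h2 := length_quotSMulTop_stableHom_le Z X hX.1
    have h3 := ih (fun y hy => hxs y (by simp [hy])) (QuotSMulTop x X) hX.2
    rw [(Submodule.quotOfListConsSMulTopEquivQuotSMulTopInner X x xs).length_eq]
    calc _ ≤ _ := h1
      _ ≤ _ := mul_le_mul_right (h2.trans h3) _
      _ = _ := by rw [List.length_cons, pow_succ]; ring

end StableHomLength

section Depth

open CategoryTheory Abelian Limits Pointwise RingTheory.Sequence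

variable {S : Type u} [CommRing S] [IsLocalRing S]

theorem length_quotient_ne_top_of_isRegular [IsNoetherianRing S] {X : Type u} [AddCommGroup X]
    [Module S X] [Module.Finite S X] {ys : List S} (hys : IsRegular X ys)
    (hdim : (ys.length : WithBot ℕ∞) = ringKrullDim S) :
    Module.length S (X ⧸ (Ideal.ofList ys • (⊤ : Submodule S X))) ≠ ⊤ := by
  set Q := X ⧸ (Ideal.ofList ys • (⊤ : Submodule S X))
  have h1 := Module.supportDim_add_length_eq_supportDim_of_isRegular ys hys
  have h2 : Module.supportDim S X ≤ ys.length := hdim ▸ Module.supportDim_le_ringKrullDim S X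
  have h3 : Module.supportDim S Q ≤ 0 := by
    rw [← h1] at h2
    change Module.supportDim S Q + _ ≤ _ at h2
    generalize Module.supportDim S Q = d at h2
    induction d with
    | bot => exact bot_le
    | coe d =>
      induction d with
      | top => exact absurd h2 (by
          intro h
          have h' : ((⊤ + (ys.length : ℕ∞) : ℕ∞) : WithBot ℕ∞) ≤ ((ys.length : ℕ∞) : WithBot ℕ∞) := h
          rw [WithBot.coe_le_coe, top_add] at h'
          exact ENat.natCast_ne_top _ (top_le_iff.mp h'))
      | coe d =>
        have : d + ys.length ≤ ys.length := by exact_mod_cast h2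
        have : d = 0 := by omega
        simp [this]
  rw [Module.supportDim_eq_ringKrullDim_quotient_annihilator] at h3
  have : Ring.KrullDimLE 0 (S ⧸ Module.annihilator S Q) := Ring.krullDimLE_iff.mpr (by simpa using h3)
  have : IsArtinianRing (S ⧸ Module.annihilator S Q) := isArtinianRing_iff_krullDimLE_zero.mpr this
  have : IsArtinian S Q := by
    let _ : Module (S ⧸ Module.annihilator S Q) Q := Module.quotientAnnihilator
    have : IsScalarTower S (S ⧸ Module.annihilator S Q) Q := ⟨fun s r q => by
      obtain ⟨r, rfl⟩ := Ideal.Quotient.mk_surjective r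
      exact mul_smul s r q⟩
    have : Module.Finite (S ⧸ Module.annihilator S Q) Q := Module.Finite.of_restrictScalars_finite S _ _
    have : IsArtinian (S ⧸ Module.annihilator S Q) Q := inferInstance
    exact isArtinian_of_surjective_algebraMap
      (Ideal.Quotient.mk_surjective (I := Module.annihilator S Q))
  rw [Module.length_ne_top_iff, isFiniteLength_iff_isNoetherian_isArtinian]
  exact ⟨inferInstance, this⟩

/-- Vanishing of the first `n` Ext groups out of the residue field. -/
def ExtResidueVanishes (S : Type u) [CommRing S] [IsLocalRing S] (n : ℕ) (M : Type u)
    [AddCommGroup M] [Module S M] : Prop :=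
  ∀ i < n, Subsingleton (Ext (ModuleCat.of S (ResidueField S)) (ModuleCat.of S M) i)

theorem ExtResidueVanishes.of_isRegular [IsNoetherianRing S] {M : Type u} [AddCommGroup M]
    [Module S M] [Module.Finite S M] {rs : List S} (hmem : ∀ r ∈ rs, r ∈ maximalIdeal S)
    (hreg : IsRegular M rs) : ExtResidueVanishes S rs.length M := by
  have : Nontrivial M := hreg.nontrivial
  refine ModuleCat.subsingleton_ext_of_exists_isRegular (maximalIdeal S)
    (ModuleCat.of S (ResidueField S)) ?_ (ModuleCat.of S M) ?_ rs hmem hreg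
  · have : Module.annihilator S (ResidueField S) = maximalIdeal S :=
      Ideal.annihilator_quotient
    change Module.support S (ResidueField S) ⊆ _
    rw [Module.support_eq_zeroLocus, this]
  · refine lt_top_iff_ne_top.mpr fun h => ?_
    have := Submodule.eq_bot_of_le_smul_of_le_jacobson_bot (maximalIdeal S) (⊤ : Submodule S M)
      Module.Finite.fg_top h.ge (maximalIdeal_le_jacobson _)
    exact bot_ne_top this.symm

theorem ExtResidueVanishes.eq_zero_of_smul_eq_zero {n : ℕ} (hn : 0 < n) {M : Type u}
    [AddCommGroup M] [Module S M] (h : ExtResidueVanishes S n M) (v : M)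
    (hv : ∀ y ∈ maximalIdeal S, y • v = 0) : v = 0 := by
  have h0 : Subsingleton (Ext (ModuleCat.of S (ResidueField S)) (ModuleCat.of S M) 0) := h 0 hn
  have h1 := Ext.addEquiv₀.subsingleton_congr.mp h0
  have : Subsingleton (ResidueField S →ₗ[S] M) := (ModuleCat.homAddEquiv
    (M := ModuleCat.of S (ResidueField S)) (N := ModuleCat.of S M)).symm.subsingleton
  let φ : ResidueField S →ₗ[S] M :=
    Submodule.liftQ (maximalIdeal S) (LinearMap.toSpanSingleton S M v) (fun y hy => by
      simpa using hv y hy)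
  have : φ 1 = v := by
    change (1 : S) • v = v
    exact one_smul S v
  rw [← this, Subsingleton.elim φ 0]
  rfl

theorem ExtResidueVanishes.eq_zero_of_pow_smul_eq_zero {n : ℕ} (hn : 0 < n) {M : Type u}
    [AddCommGroup M] [Module S M] (h : ExtResidueVanishes S n M) (c : ℕ) : ∀ (v : M),
    (∀ y ∈ maximalIdeal S ^ c, y • v = 0) → v = 0 := by
  induction c with
  | zero => intro v hv; simpa using hv 1 (by simp)
  | succ c ih =>
    intro v hv
    refine ih v fun y hy => h.eq_zero_of_smul_eq_zero hn _ fun z hz => ?_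
    rw [smul_smul]
    exact hv _ (by rw [pow_succ']; exact Ideal.mul_mem_mul hz hy)

theorem ExtResidueVanishes.quotSMulTop {n : ℕ} {M : Type u}
    [AddCommGroup M] [Module S M] (h : ExtResidueVanishes S (n + 1) M) {x : S}
    (hx : IsSMulRegular M x) : ExtResidueVanishes S n (QuotSMulTop x M) := by
  intro i hi
  have zero1 := AddCommGrpCat.isZero_of_iff_subsingleton.mpr (h i (by omega))
  have zero2 := AddCommGrpCat.isZero_of_iff_subsingleton.mpr (h (i + 1) (by omega))
  have hx' : IsSMulRegular (ModuleCat.of S M) x := hx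
  exact AddCommGrpCat.subsingleton_of_isZero <| ShortComplex.Exact.isZero_of_both_zeros
    ((Ext.covariant_sequence_exact₃' (ModuleCat.of S (ResidueField S))
      hx'.smulShortComplex_shortExact) i (i + 1) rfl)
    (zero1.eq_zero_of_src _) (zero2.eq_zero_of_tgt _)

theorem isWeaklyRegular_of_ext (c : ℕ) (rs : List S) : ∀ (B M : Type u) [AddCommGroup B]
    [Module S B] [AddCommGroup M] [Module S M], IsWeaklyRegular B rs →
    (∀ y ∈ maximalIdeal S ^ c, ∃ (g : M →ₗ[S] B) (h : B →ₗ[S] M), h.comp g = y • LinearMap.id) →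
    ExtResidueVanishes S rs.length M → IsWeaklyRegular M rs := by
  induction rs with
  | nil => intros; exact IsWeaklyRegular.nil _ _
  | cons x rs ih =>
    intro B M _ _ _ _ hB hfac hext
    rw [isWeaklyRegular_cons_iff] at hB ⊢
    have hx : IsSMulRegular M x := by
      rw [isSMulRegular_iff_right_eq_zero_of_smul]
      intro v hv
      refine hext.eq_zero_of_pow_smul_eq_zero (by simp) c v fun y hy => ?_
      obtain ⟨g, h, hgh⟩ := hfac y hy
      have : g v = 0 := hB.1.right_eq_zero_of_smul (by rw [← map_smul, hv, map_zero])
      have h2 := LinearMap.congr_fun hgh v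
      rw [LinearMap.comp_apply, this, map_zero] at h2
      exact h2.symm
    refine ⟨hx, ih (QuotSMulTop x B) (QuotSMulTop x M) hB.2 (fun y hy => ?_)
      (hext.quotSMulTop hx)⟩
    obtain ⟨g, h, hgh⟩ := hfac y hy
    refine ⟨QuotSMulTop.map x g, QuotSMulTop.map x h, ?_⟩
    rw [← QuotSMulTop.map_comp, hgh]
    ext v
    rfl

end Depth

section Ext1

variable {Λ : Type u} [Ring Λ]

theorem Ext1Vanishes.exists_lift {Z L Y : Type u} [AddCommGroup Z] [Module Λ Z] [AddCommGroup L]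
    [Module Λ L] [AddCommGroup Y] [Module Λ Y] {π : L →ₗ[Λ] Y} (hπ : Function.Surjective π)
    (h : Ext1Vanishes Λ Z (LinearMap.ker π)) (u : Z →ₗ[Λ] Y) : ∃ v : Z →ₗ[Λ] L, π.comp v = u := by
  let E : Submodule Λ (Z × L) :=
    LinearMap.ker (u.comp (LinearMap.fst Λ Z L) - π.comp (LinearMap.snd Λ Z L))
  have hE : ∀ w : E, u w.1.1 = π w.1.2 := fun w => sub_eq_zero.mp w.2
  let g : E →ₗ[Λ] Z := (LinearMap.fst Λ Z L).comp E.subtype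
  have hg : Function.Surjective g := by
    intro z
    obtain ⟨l, hl⟩ := hπ (u z)
    exact ⟨⟨(z, l), sub_eq_zero.mpr hl.symm⟩, rfl⟩
  let e : LinearMap.ker g ≃ₗ[Λ] LinearMap.ker π :=
    { toFun := fun w => ⟨w.1.1.2, by
        have h1 : w.1.1.1 = 0 := w.2
        rw [LinearMap.mem_ker, ← hE, h1, map_zero]⟩
      map_add' := fun _ _ => rfl
      map_smul' := fun _ _ => rfl
      invFun := fun l => ⟨⟨(0, l.1), sub_eq_zero.mpr (by
        have h1 : π l.1 = 0 := l.2
        simp [h1])⟩, rfl⟩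
      left_inv := by
        intro w
        have h1 : w.1.1.1 = 0 := w.2
        ext
        · exact h1.symm
        · rfl
      right_inv := fun _ => rfl }
  obtain ⟨s, hs⟩ := h E _ _ g hg ⟨e⟩
  refine ⟨(LinearMap.snd Λ Z L).comp (E.subtype.comp s), ?_⟩
  ext z
  have h1 : (s z).1.1 = z := LinearMap.congr_fun hs z
  have h2 := hE (s z)
  rw [h1] at h2
  exact h2.symm

theorem Ext1Vanishes.exists_extension {F Z L : Type u} [AddCommGroup Z] [Module Λ Z]
    [AddCommGroup L] [Module Λ L] [AddCommGroup F] [Module Λ F] {p : F →ₗ[Λ] Z}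
    (hp : Function.Surjective p) (h : Ext1Vanishes Λ Z L) (v : LinearMap.ker p →ₗ[Λ] L) :
    ∃ w : F →ₗ[Λ] L, ∀ k : LinearMap.ker p, w k = v k := by
  let D : Submodule Λ (F × L) := LinearMap.range ((LinearMap.ker p).subtype.prod (-v))
  let E := (F × L) ⧸ D
  have hD : D ≤ LinearMap.ker (p.comp (LinearMap.fst Λ F L)) := by
    rintro _ ⟨k, rfl⟩
    exact k.2
  let g : E →ₗ[Λ] Z := D.liftQ (p.comp (LinearMap.fst Λ F L)) hD
  have hg : Function.Surjective g := by
    intro z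
    obtain ⟨x, hx⟩ := hp z
    exact ⟨D.mkQ (x, 0), hx⟩
  let j : L →ₗ[Λ] LinearMap.ker g :=
    (D.mkQ.comp (LinearMap.inr Λ F L)).codRestrict _ fun l => by
      change p 0 = 0
      exact map_zero p
  have hj : Function.Bijective j := by
    constructor
    · rw [← LinearMap.ker_eq_bot, LinearMap.ker_eq_bot']
      intro l hl
      have h1 : D.mkQ (0, l) = 0 := congrArg Subtype.val hl
      rw [Submodule.mkQ_apply, Submodule.Quotient.mk_eq_zero] at h1
      obtain ⟨k, hk⟩ := h1
      have hk1 : (k : F) = 0 := congrArg Prod.fst hk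
      have hk2 : -v k = l := congrArg Prod.snd hk
      have : k = 0 := Subtype.ext hk1
      rw [← hk2, this, map_zero, neg_zero]
    · rintro ⟨w, hw⟩
      obtain ⟨⟨x, l⟩, rfl⟩ := D.mkQ_surjective w
      have hx : p x = 0 := hw
      refine ⟨v ⟨x, hx⟩ + l, Subtype.ext ?_⟩
      change D.mkQ (0, v ⟨x, hx⟩ + l) = D.mkQ (x, l)
      rw [← sub_eq_zero, ← map_sub, Submodule.mkQ_apply, Submodule.Quotient.mk_eq_zero]
      refine ⟨-⟨x, hx⟩, ?_⟩
      ext <;> simp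
  let e := LinearEquiv.ofBijective j hj
  obtain ⟨s, hs⟩ := h E _ _ g hg ⟨e.symm⟩
  have hmem : ∀ x : F, D.mkQ (x, 0) - s (p x) ∈ LinearMap.ker g := by
    intro x
    rw [LinearMap.mem_ker, map_sub]
    have h1 : g (s (p x)) = p x := LinearMap.congr_fun hs (p x)
    rw [h1]
    exact sub_self _
  let q : F →ₗ[Λ] LinearMap.ker g :=
    (D.mkQ.comp (LinearMap.inl Λ F L) - s.comp p).codRestrict _ hmem
  refine ⟨e.symm.toLinearMap.comp q, fun k => ?_⟩
  rw [LinearMap.comp_apply, LinearEquiv.coe_coe, LinearEquiv.symm_apply_eq]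
  ext
  change D.mkQ ((k : F), 0) - s (p k) = D.mkQ (0, v k)
  have hk : p k = 0 := k.2
  rw [hk, map_zero, sub_zero, ← sub_eq_zero, ← map_sub, Submodule.mkQ_apply,
    Submodule.Quotient.mk_eq_zero]
  refine ⟨k, ?_⟩
  ext <;> simp

theorem Ext1Vanishes.of_lift_of_extend {F Z L Y : Type u} [AddCommGroup Z] [Module Λ Z]
    [AddCommGroup L] [Module Λ L] [AddCommGroup F] [Module Λ F] [AddCommGroup Y] [Module Λ Y]
    [Module.Projective Λ F] {p : F →ₗ[Λ] Z} (hp : Function.Surjective p) {π : L →ₗ[Λ] Y}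
    (hπ : Function.Surjective π) (h1 : Ext1Vanishes Λ (LinearMap.ker p) (LinearMap.ker π))
    (h2 : Ext1Vanishes Λ Z L) : Ext1Vanishes Λ Z Y := by
  rintro E _ _ g hg ⟨e⟩
  obtain ⟨l, hl⟩ := Module.projective_lifting_property g p hg
  let u : LinearMap.ker p →ₗ[Λ] Y := e.toLinearMap.comp
    ((l.comp (LinearMap.ker p).subtype).codRestrict _ fun k => by
      change g (l k) = 0
      rw [← LinearMap.comp_apply, hl]
      exact k.2)
  obtain ⟨v, hv⟩ := h1.exists_lift hπ u
  obtain ⟨w, hw⟩ := h2.exists_extension hp v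
  let ι : Y →ₗ[Λ] E := (LinearMap.ker g).subtype.comp e.symm.toLinearMap
  have hι : ∀ y, g (ι y) = 0 := fun y => (e.symm y).2
  let t : F →ₗ[Λ] E := l - ι.comp (π.comp w)
  have ht : LinearMap.ker p ≤ LinearMap.ker t := by
    intro k hk
    have h3 : π (v ⟨k, hk⟩) = u ⟨k, hk⟩ := LinearMap.congr_fun hv _
    have h4 : w k = v ⟨k, hk⟩ := hw ⟨k, hk⟩
    rw [LinearMap.mem_ker]
    change l k - ι (π (w k)) = 0
    rw [h4, h3]
    simp [ι, u]
  refine ⟨((LinearMap.ker p).liftQ t ht).comp (p.quotKerEquivOfSurjective hp).symm.toLinearMap, ?_⟩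
  ext z
  obtain ⟨x, rfl⟩ := hp z
  have h3 : (p.quotKerEquivOfSurjective hp).symm (p x) = Submodule.Quotient.mk x := by
    rw [LinearEquiv.symm_apply_eq]; rfl
  rw [LinearMap.comp_apply, LinearMap.comp_apply, LinearEquiv.coe_coe, h3, Submodule.liftQ_apply]
  change g (l x - ι _) = p x
  rw [map_sub, hι, sub_zero, ← LinearMap.comp_apply, hl]

theorem Ext1Vanishes.of_subsingleton {Z Y : Type u} [AddCommGroup Z] [Module Λ Z]
    [AddCommGroup Y] [Module Λ Y] [Subsingleton Z] : Ext1Vanishes Λ Z Y :=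
  fun _ _ _ _ _ _ => ⟨0, LinearMap.ext fun _ => Subsingleton.elim _ _⟩

end Ext1

section Syzygies

open Pointwise RingTheory.Sequence

variable {S : Type u} [CommRing S]

theorem quotSMulTop_map_injective {x : S} {A B C : Type u} [AddCommGroup A]
    [Module S A] [AddCommGroup B] [Module S B] [AddCommGroup C] [Module S C] {i : A →ₗ[S] B}
    {q : B →ₗ[S] C} (hi : Function.Injective i) (hex : Function.Exact i q)
    (hC : IsSMulRegular C x) : Function.Injective (QuotSMulTop.map x i) := by
  rw [← LinearMap.ker_eq_bot, LinearMap.ker_eq_bot']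
  intro a ha
  obtain ⟨a, rfl⟩ := Submodule.mkQ_surjective _ a
  have ha' : i a ∈ (x • ⊤ : Submodule S B) := (Submodule.Quotient.mk_eq_zero _).mp ha
  obtain ⟨b, -, hb⟩ := (Submodule.mem_smul_pointwise_iff_exists _ _ _).mp ha'
  have h1 : q b = 0 := hC.right_eq_zero_of_smul (by
    rw [← map_smul, hb, hex.apply_apply_eq_zero])
  obtain ⟨a', rfl⟩ := (hex b).mp h1
  rw [← map_smul] at hb
  rw [← hi hb]
  exact (Submodule.Quotient.mk_eq_zero _).mpr
    (Submodule.smul_mem_pointwise_smul _ _ _ Submodule.mem_top)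

theorem isWeaklyRegular_of_exact (rs : List S) : ∀ (A B C : Type u) [AddCommGroup A]
    [Module S A] [AddCommGroup B] [Module S B] [AddCommGroup C] [Module S C] (i : A →ₗ[S] B)
    (q : B →ₗ[S] C), Function.Injective i → Function.Exact i q → Function.Surjective q →
    IsWeaklyRegular B rs → IsWeaklyRegular C rs → IsWeaklyRegular A rs := by
  induction rs with
  | nil => intros; exact IsWeaklyRegular.nil _ _
  | cons x rs ih =>
    intro A B C _ _ _ _ _ _ i q hi hex hq hB hC
    rw [isWeaklyRegular_cons_iff] at hB hC ⊢
    exact ⟨hB.1.of_injective i hi, ih _ _ _ (QuotSMulTop.map x i) (QuotSMulTop.map x q)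
      (quotSMulTop_map_injective hi hex hC.1) (QuotSMulTop.map_exact x hex hq)
      (QuotSMulTop.map_surjective x hq) hB.2 hC.2⟩

theorem isWeaklyRegular_append_of_exact (x : S) (rs : List S) : ∀ (A B C : Type u)
    [AddCommGroup A] [Module S A] [AddCommGroup B] [Module S B] [AddCommGroup C] [Module S C]
    (i : A →ₗ[S] B) (q : B →ₗ[S] C), Function.Injective i → Function.Exact i q →
    Function.Surjective q → IsWeaklyRegular B (rs ++ [x]) → IsWeaklyRegular C rs →
    IsWeaklyRegular A (rs ++ [x]) := by
  induction rs with
  | nil =>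
    intro A B C _ _ _ _ _ _ i q hi _ _ hB _
    rw [List.nil_append, isWeaklyRegular_singleton_iff] at hB ⊢
    exact hB.of_injective i hi
  | cons y rs ih =>
    intro A B C _ _ _ _ _ _ i q hi hex hq hB hC
    rw [List.cons_append, isWeaklyRegular_cons_iff] at hB ⊢
    rw [isWeaklyRegular_cons_iff] at hC
    exact ⟨hB.1.of_injective i hi, ih _ _ _ (QuotSMulTop.map y i) (QuotSMulTop.map y q)
      (quotSMulTop_map_injective hi hex hC.1) (QuotSMulTop.map_exact y hex hq)
      (QuotSMulTop.map_surjective y hq) hB.2 hC.2⟩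

theorem length_quotient_le_of_exact (rs : List S) : ∀ (A B C : Type u) [AddCommGroup A]
    [Module S A] [AddCommGroup B] [Module S B] [AddCommGroup C] [Module S C] (i : A →ₗ[S] B)
    (q : B →ₗ[S] C), Function.Injective i → Function.Exact i q → Function.Surjective q →
    IsWeaklyRegular C rs → Module.length S (A ⧸ (Ideal.ofList rs • (⊤ : Submodule S A))) ≤
      Module.length S (B ⧸ (Ideal.ofList rs • (⊤ : Submodule S B))) := by
  induction rs with
  | nil =>
    intro A B C _ _ _ _ _ _ i q hi _ _ _
    have e : ∀ (X : Type u) [AddCommGroup X] [Module S X],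
        Module.length S (X ⧸ (Ideal.ofList ([] : List S) • (⊤ : Submodule S X))) =
          Module.length S X := fun X _ _ =>
      (Submodule.quotEquivOfEqBot _ (by rw [Ideal.ofList_nil, Submodule.bot_smul])).length_eq
    rw [e, e]
    exact Module.length_le_of_injective i hi
  | cons x rs ih =>
    intro A B C _ _ _ _ _ _ i q hi hex hq hC
    rw [isWeaklyRegular_cons_iff] at hC
    rw [(Submodule.quotOfListConsSMulTopEquivQuotSMulTopInner A x rs).length_eq,
      (Submodule.quotOfListConsSMulTopEquivQuotSMulTopInner B x rs).length_eq]
    exact ih _ _ _ (QuotSMulTop.map x i) (QuotSMulTop.map x q)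
      (quotSMulTop_map_injective hi hex hC.1) (QuotSMulTop.map_exact x hex hq)
      (QuotSMulTop.map_surjective x hq) hC.2

theorem isWeaklyRegular_fin {rs : List S} (hrs : IsWeaklyRegular S rs) (n : ℕ) :
    IsWeaklyRegular (Fin n → S) rs := by
  have := IsWeaklyRegular.isWeaklyRegular_rTensor (M₂ := Fin n → S) hrs
  exact ((TensorProduct.lid S (Fin n → S)).isWeaklyRegular_congr rs).mp this

variable [IsLocalRing S]

theorem IsTame.ker {c : ℕ} {F Z : Type u} [AddCommGroup F] [Module S F] [Module.Projective S F]
    [AddCommGroup Z] [Module S Z] (hZ : IsTame S c Z) {p : F →ₗ[S] Z}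
    (hp : Function.Surjective p) : IsTame S c (LinearMap.ker p) := by
  intro y hy
  obtain ⟨s, hs⟩ := (hZ y hy).exists_lift hp
  have hmem : ∀ x : F, (y • LinearMap.id - s.comp p : F →ₗ[S] F) x ∈ LinearMap.ker p := by
    intro x
    have h1 : p (s (p x)) = y • p x := LinearMap.congr_fun hs (p x)
    rw [LinearMap.mem_ker]
    simp [h1]
  refine ⟨F, _, _, inferInstance, (LinearMap.ker p).subtype,
    (y • LinearMap.id - s.comp p : F →ₗ[S] F).codRestrict _ hmem, ?_⟩
  ext k
  simp

/-- Finitely generated tame modules on which `rs` is weakly regular. -/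
structure IsTameLattice (rs : List S) (Z : Type u) [AddCommGroup Z] [Module S Z] : Prop where
  finite : Module.Finite S Z
  exists_tame : ∃ c, IsTame S c Z
  isWeaklyRegular : IsWeaklyRegular Z rs

theorem IsTameLattice.ker [IsNoetherianRing S] {rs : List S} (hrs : IsWeaklyRegular S rs) {n : ℕ}
    {Z : Type u} [AddCommGroup Z] [Module S Z] (hZ : IsTameLattice rs Z)
    {p : (Fin n → S) →ₗ[S] Z} (hp : Function.Surjective p) :
    IsTameLattice rs (LinearMap.ker p) where
  finite := inferInstance
  exists_tame := hZ.exists_tame.imp fun _ h => h.ker hp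
  isWeaklyRegular := isWeaklyRegular_of_exact rs _ _ _ (LinearMap.ker p).subtype p
    (Submodule.subtype_injective _) (LinearMap.exact_subtype_ker_map p) hp
    (isWeaklyRegular_fin hrs n) hZ.isWeaklyRegular

theorem free_localizedModule_of_isTame {c : ℕ} {Z : Type u} [AddCommGroup Z] [Module S Z]
    [Module.Finite S Z] (hZ : IsTame S c Z) (p : Ideal S) [p.IsPrime] (hp : p ≠ maximalIdeal S) :
    Module.Free (Localization.AtPrime p) (LocalizedModule p.primeCompl Z) := by
  obtain ⟨y, hy, hyp⟩ : ∃ y ∈ maximalIdeal S ^ c, y ∉ p := by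
    by_contra! h
    have h1 : maximalIdeal S ≤ p := Ideal.IsPrime.le_of_pow_le (n := c) h
    exact hp (((maximalIdeal.isMaximal S).eq_of_le (Ideal.IsPrime.ne_top inferInstance) h1).symm)
  obtain ⟨P, _, _, hP, g, h, hgh⟩ := hZ y hy
  have hu : IsUnit (algebraMap S (Localization.AtPrime p) y) :=
    IsLocalization.map_units (M := p.primeCompl) _ ⟨y, hyp⟩
  obtain ⟨w, hw⟩ := hu.exists_left_inv
  have hproj : Module.Projective (Localization.AtPrime p) (LocalizedModule p.primeCompl Z) := by
    refine Module.Projective.of_split (LocalizedModule.map p.primeCompl g)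
      (w • LocalizedModule.map p.primeCompl h) ?_
    have h1 : (LocalizedModule.map p.primeCompl h).comp (LocalizedModule.map p.primeCompl g) =
        algebraMap S (Localization.AtPrime p) y • LinearMap.id := by
      ext z
      induction z using LocalizedModule.induction_on with
      | h z d =>
        have h2 : h (g z) = y • z := LinearMap.congr_fun hgh z
        simp only [LinearMap.comp_apply, LocalizedModule.map_mk, h2, LinearMap.smul_apply,
          LinearMap.id_apply, algebraMap_smul, LocalizedModule.smul'_mk]
    rw [LinearMap.smul_comp, h1, smul_smul, hw, one_smul]
  have : Module.Finite (Localization.AtPrime p) (LocalizedModule p.primeCompl Z) := inferInstance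
  exact Module.free_of_flat_of_isLocalRing

theorem IsTameLattice.isLatticeC [IsNoetherianRing S] {rs : List S}
    (hmem : ∀ r ∈ rs, r ∈ maximalIdeal S) (hdim : (rs.length : WithBot ℕ∞) = ringKrullDim S)
    {Z : Type u} [AddCommGroup Z] [Module S Z] [Nontrivial Z] (hZ : IsTameLattice rs Z) :
    IsLatticeC S Z := by
  have := hZ.finite
  obtain ⟨c, hc⟩ := hZ.exists_tame
  exact ⟨hZ.finite, ⟨rs, hmem,
    RingTheory.Sequence.IsRegular.of_isWeaklyRegular_of_mem_maximalIdeal Z hmem hZ.isWeaklyRegular,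
    hdim⟩, fun p _ hp => free_localizedModule_of_isTame hc p hp⟩

theorem IsTameLattice.ext1Vanishes_of_isLatInjectiveC [IsNoetherianRing S] {rs : List S}
    (hmem : ∀ r ∈ rs, r ∈ maximalIdeal S) (hdim : (rs.length : WithBot ℕ∞) = ringKrullDim S)
    {Z L : Type u} [AddCommGroup Z] [Module S Z] [AddCommGroup L] [Module S L]
    (hZ : IsTameLattice rs Z) (hL : IsLatInjectiveC S L) : Ext1Vanishes S Z L := by
  rcases subsingleton_or_nontrivial Z with _ | _
  · exact Ext1Vanishes.of_subsingleton
  · exact hL.2 Z _ _ (hZ.isLatticeC hmem hdim)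

theorem IsTameLattice.ext1Vanishes [IsNoetherianRing S] {rs : List S} (hrs : IsWeaklyRegular S rs)
    (hmem : ∀ r ∈ rs, r ∈ maximalIdeal S) (hdim : (rs.length : WithBot ℕ∞) = ringKrullDim S)
    (t : ℕ) : ∀ (Z Y : Type u) [AddCommGroup Z] [Module S Z] [AddCommGroup Y] [Module S Y],
      IsTameLattice rs Z → HasLatInjResOfLengthC S t Y → Ext1Vanishes S Z Y := by
  induction t with
  | zero =>
    intro Z Y _ _ _ _ hZ hY
    exact hZ.ext1Vanishes_of_isLatInjectiveC hmem hdim hY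
  | succ t ih =>
    intro Z Y _ _ _ _ hZ hY
    obtain ⟨L, _, _, π, hL, hπ, hker⟩ := hY
    have := hZ.finite
    obtain ⟨n, p, hp⟩ := Module.Finite.exists_fin' S Z
    exact Ext1Vanishes.of_lift_of_extend hp hπ (ih _ _ (hZ.ker hrs hp) hker)
      (hZ.ext1Vanishes_of_isLatInjectiveC hmem hdim hL)

end Syzygies

section HLength

open RingTheory.Sequence

variable {S : Type u} [CommRing S]

theorem stableHomMap_surjective (Z : Type u) {X Y : Type u} [AddCommGroup Z] [Module S Z]
    [AddCommGroup X] [Module S X] [AddCommGroup Y] [Module S Y] {g : X →ₗ[S] Y} {i : Y →ₗ[S] X}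
    (h : g.comp i = LinearMap.id) : Function.Surjective (stableHomMap Z g) := by
  intro w
  obtain ⟨f, rfl⟩ := stableHomMk_surjective _ _ w
  refine ⟨stableHomMk _ _ (i.comp f), ?_⟩
  rw [stableHomMap_mk, ← LinearMap.comp_assoc, h, LinearMap.id_comp]

theorem length_stableHom_fst_le (Z X Y : Type u) [AddCommGroup Z] [Module S Z]
    [AddCommGroup X] [Module S X] [AddCommGroup Y] [Module S Y] :
    Module.length S (stableHom S S Z X) ≤ Module.length S (stableHom S S Z (X × Y)) :=
  Module.length_le_of_surjective _ (stableHomMap_surjective Z (LinearMap.fst_comp_inl S X Y))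

theorem length_stableHom_snd_le (Z X Y : Type u) [AddCommGroup Z] [Module S Z]
    [AddCommGroup X] [Module S X] [AddCommGroup Y] [Module S Y] :
    Module.length S (stableHom S S Z Y) ≤ Module.length S (stableHom S S Z (X × Y)) :=
  Module.length_le_of_surjective _ (stableHomMap_surjective Z (LinearMap.snd_comp_inr S X Y))

theorem length_stableHom_prod_le (Z X Y : Type u) [AddCommGroup Z] [Module S Z]
    [AddCommGroup X] [Module S X] [AddCommGroup Y] [Module S Y] :
    Module.length S (stableHom S S Z (X × Y)) ≤
      Module.length S (stableHom S S Z X) + Module.length S (stableHom S S Z Y) := by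
  rw [← Module.length_prod]
  refine Module.length_le_of_injective ((stableHomMap Z (LinearMap.fst S X Y)).prod
    (stableHomMap Z (LinearMap.snd S X Y))) ?_
  rw [← LinearMap.ker_eq_bot, LinearMap.ker_eq_bot']
  intro w hw
  obtain ⟨f, rfl⟩ := stableHomMk_surjective _ _ w
  have h1 : stableHomMap Z (LinearMap.fst S X Y) (stableHomMk _ _ f) = 0 := congrArg Prod.fst hw
  have h2 : stableHomMap Z (LinearMap.snd S X Y) (stableHomMk _ _ f) = 0 := congrArg Prod.snd hw
  rw [stableHomMap_mk, stableHomMk_eq_zero_iff] at h1 h2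
  rw [stableHomMk_eq_zero_iff]
  convert (h1.comp_left (LinearMap.inl S X Y)).add (h2.comp_left (LinearMap.inr S X Y)) using 1
  ext z <;> simp

theorem hLengthC_eq (Z G : Type u) [AddCommGroup Z] [Module S Z] [AddCommGroup G] [Module S G] :
    hLengthC S Z G = ((Module.length S (stableHom S S Z (Z × G)) : ℕ∞) : WithBot ℕ∞) :=
  moduleLength_eq_length _

variable [IsLocalRing S]

theorem exists_length_quotient_le [IsNoetherianRing S] {rs : List S} (hrs : IsRegular S rs)
    (hmem : ∀ r ∈ rs, r ∈ maximalIdeal S) (hdim : (rs.length : WithBot ℕ∞) = ringKrullDim S)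
    (n : ℕ) : ∃ l : ℕ, ∀ (Z : Type u) [AddCommGroup Z] [Module S Z] (f : (Fin n → S) →ₗ[S] Z),
      Function.Surjective f →
        Module.length S (Z ⧸ (Ideal.ofList rs • (⊤ : Submodule S Z))) ≤ l := by
  have hfin : Module.length S
      ((Fin n → S) ⧸ (Ideal.ofList rs • (⊤ : Submodule S (Fin n → S)))) ≠ ⊤ := by
    rcases subsingleton_or_nontrivial (Fin n → S) with _ | _
    · rw [Module.length_eq_zero_iff.mpr inferInstance]
      exact ENat.zero_ne_top
    · exact length_quotient_ne_top_of_isRegular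
        (IsRegular.of_isWeaklyRegular_of_mem_maximalIdeal _ hmem
          (isWeaklyRegular_fin hrs.toIsWeaklyRegular n)) hdim
  obtain ⟨l, hl⟩ := ENat.ne_top_iff_exists.mp hfin
  refine ⟨l, fun Z _ _ f hf => ?_⟩
  rw [hl]
  refine Module.length_le_of_surjective (Submodule.mapQ _ _ f
    (Submodule.smul_top_le_comap_smul_top _ f)) ?_
  intro z
  obtain ⟨z, rfl⟩ := Submodule.mkQ_surjective _ z
  obtain ⟨w, rfl⟩ := hf z
  exact ⟨Submodule.Quotient.mk w, rfl⟩

theorem exists_length_stableHom_le [IsNoetherianRing S] {rs : List S} (hrs : IsRegular S rs)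
    (hmem : ∀ r ∈ rs, r ∈ maximalIdeal S) (hdim : (rs.length : WithBot ℕ∞) = ringKrullDim S)
    {G : Type u} [AddCommGroup G] [Module S G] (hG : IsLatticeC S G) (c n : ℕ) :
    ∃ l : ℕ, ∀ (Z : Type u) [AddCommGroup Z] [Module S Z] (f : (Fin n → S) →ₗ[S] Z),
      Function.Surjective f → IsTame S c Z → IsWeaklyRegular Z rs →
        Module.length S (stableHom S S Z (Z × G)) ≤ l := by
  obtain ⟨hGfin, ⟨ys, hysmem, hys, hysdim⟩, -⟩ := hG
  obtain ⟨l₁, hl₁⟩ := exists_length_quotient_le hrs hmem hdim n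
  obtain ⟨l₂, hl₂⟩ := ENat.ne_top_iff_exists.mp (length_quotient_ne_top_of_isRegular hys hysdim)
  refine ⟨c ^ rs.length * (n * l₁) + c ^ ys.length * (n * l₂), fun Z _ _ f hf hc hZ => ?_⟩
  refine (length_stableHom_prod_le Z Z G).trans ?_
  push_cast
  refine add_le_add ((length_stableHom_le hf hc rs hmem Z hZ).trans ?_)
    ((length_stableHom_le hf hc ys hysmem G hys.toIsWeaklyRegular).trans ?_)
  · gcongr
    exact hl₁ Z f hf
  · rw [← hl₂]

theorem IsTameLattice.le_length_stableHom [IsNoetherianRing S] {rs : List S} (hrs : IsRegular S rs)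
    (hmem : ∀ r ∈ rs, r ∈ maximalIdeal S) (hdim : (rs.length : WithBot ℕ∞) = ringKrullDim S)
    {G : Type u} [AddCommGroup G] [Module S G] {α : G →ₗ[S] ResidueField S}
    (hα : IsResidueApprox S G α) {Z : Type u} [AddCommGroup Z] [Module S Z]
    (hZ : IsTameLattice rs Z) (hmax : ∀ (φ : Z →ₗ[S] S) (z : Z), φ z ∈ maximalIdeal S) {n : ℕ}
    {f : (Fin n → S) →ₗ[S] Z} (hf : Function.Surjective f)
    (hk : LinearMap.ker f ≤ maximalIdeal S • ⊤) :
    (n : ℕ∞) ≤ Module.length S (stableHom S S Z G) := by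
  refine (le_length_hom_residueField hf hk).trans ?_
  obtain ⟨-, hsurj, ⟨t, ht⟩, -⟩ := hα
  refine Module.length_le_of_surjective (stableHomLift (LinearMap.compRight S α) ?_) ?_
  · intro g hg
    obtain ⟨s, hs⟩ := hg.exists_lift (Finsupp.linearCombination_id_surjective S G)
    ext z
    change α (g z) = 0
    rw [← hs, LinearMap.comp_apply, Finsupp.linearCombination_apply, Finsupp.sum, map_sum]
    refine Finset.sum_eq_zero fun i _ => ?_
    have h1 : s z i ∈ maximalIdeal S := hmax ((Finsupp.lapply i).comp s) z
    have h2 : residue S (s z i) = 0 := (residue_eq_zero_iff _).mpr h1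
    rw [map_smul, Algebra.smul_def, ResidueField.algebraMap_eq, h2, zero_mul]
  · intro φ
    obtain ⟨v, hv⟩ := (hZ.ext1Vanishes hrs.toIsWeaklyRegular hmem hdim t Z _ ht).exists_lift
      hsurj φ
    exact ⟨stableHomMk _ _ v, (stableHomLift_mk _ _ _).trans hv⟩

end HLength

section Indecomposable

theorem isPrecomplete_of_finite {S : Type u} [CommRing S] (I : Ideal S) [IsPrecomplete I S]
    (M : Type u) [AddCommGroup M] [Module S M] [Module.Finite S M] : IsPrecomplete I M := by
  rw [← AdicCompletion.of_surjective_iff]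
  intro z
  obtain ⟨w, rfl⟩ := AdicCompletion.ofTensorProduct_surjective_of_finite I M z
  induction w using TensorProduct.induction_on with
  | zero => exact ⟨0, by simp⟩
  | tmul r x =>
    obtain ⟨a, rfl⟩ := AdicCompletion.of_surjective I S r
    refine ⟨a • x, ?_⟩
    ext n
    rw [AdicCompletion.ofTensorProduct_tmul, AdicCompletion.smul_eval, map_smul]
    rfl
  | add w₁ w₂ h₁ h₂ =>
    obtain ⟨x₁, h₁⟩ := h₁
    obtain ⟨x₂, h₂⟩ := h₂
    exact ⟨x₁ + x₂, by rw [map_add, map_add, h₁, h₂]⟩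

theorem exists_linearMap_limit {S : Type u} [CommRing S] (I : Ideal S) {M : Type u}
    [AddCommGroup M] [Module S M] [IsPrecomplete I M] [IsHausdorff I M] (q : ℕ → (M →ₗ[S] M))
    (hq : ∀ n x, q (n + 1) x - q n x ∈ (I ^ n • ⊤ : Submodule S M)) :
    ∃ ε : M →ₗ[S] M, ∀ n x, q n x - ε x ∈ (I ^ n • ⊤ : Submodule S M) := by
  have hle : ∀ {m n : ℕ}, m ≤ n → (I ^ n • ⊤ : Submodule S M) ≤ I ^ m • ⊤ := fun h =>
    Submodule.smul_mono_left (Ideal.pow_le_pow_right h)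
  have hcauchy : ∀ x {m n : ℕ}, m ≤ n → q m x ≡ q n x [SMOD (I ^ m • ⊤ : Submodule S M)] := by
    intro x m n hmn
    induction n, hmn using Nat.le_induction with
    | base => rfl
    | succ n hmn ih =>
      refine ih.trans (SModEq.symm ?_)
      rw [SModEq.sub_mem]
      exact hle hmn (hq n x)
  choose ε hε using fun x => IsPrecomplete.prec ‹_› (hcauchy x)
  have huniq : ∀ x y, (∀ n, q n x - y ∈ (I ^ n • ⊤ : Submodule S M)) → ε x = y := by
    intro x y hy
    rw [IsHausdorff.eq_iff_smodEq (I := I)]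
    exact fun n => (hε x n).symm.trans (SModEq.sub_mem.mpr (hy n))
  have hmem : ∀ n x, q n x - ε x ∈ (I ^ n • ⊤ : Submodule S M) :=
    fun n x => SModEq.sub_mem.mp (hε x n)
  refine ⟨{ toFun := ε, map_add' := ?_, map_smul' := ?_ }, hmem⟩
  · intro x y
    refine huniq _ _ fun n => ?_
    rw [map_add, add_sub_add_comm]
    exact add_mem (hmem n x) (hmem n y)
  · intro s x
    refine huniq _ _ fun n => ?_
    rw [map_smul, RingHom.id_apply, ← smul_sub]
    exact Submodule.smul_mem _ _ (hmem n x)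

theorem IsIndecomposable.eq_zero_or_eq_one {S : Type u} [Ring S] {M : Type u} [AddCommGroup M]
    [Module S M] (hM : IsIndecomposable S M) {e : Module.End S M} (he : IsIdempotentElem e) :
    e = 0 ∨ e = 1 := by
  rcases hM.2 _ _ (LinearMap.IsIdempotentElem.isCompl he) with h | h
  · exact Or.inl (LinearMap.range_eq_bot.mp h)
  · refine Or.inr (LinearMap.ext fun x => LinearMap.ker_eq_bot.mp h ?_)
    exact LinearMap.congr_fun he x

theorem isIndecomposable_of_idempotent {S : Type u} [Ring S] {M : Type u} [AddCommGroup M]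
    [Module S M] [Nontrivial M]
    (h : ∀ e : Module.End S M, IsIdempotentElem e → e = 0 ∨ e = 1) : IsIndecomposable S M := by
  refine ⟨inferInstance, fun A B hAB => ?_⟩
  rcases h _ (Submodule.isIdempotentElem_projection hAB) with h | h
  · refine Or.inl (eq_bot_iff.mpr fun x hx => ?_)
    have := Submodule.projection_apply_of_mem_left hAB hx
    rw [h] at this
    simpa using this.symm
  · refine Or.inr (eq_bot_iff.mpr fun x hx => ?_)
    have := Submodule.projection_apply_of_mem_right hAB hx
    rw [h] at this
    simpa using this

theorem FactorsThroughProjective.of_comp_bijective {S M N : Type u} [CommRing S]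
    [AddCommGroup M] [Module S M] [AddCommGroup N] [Module S N]
    {f : M →ₗ[S] N} {g : M →ₗ[S] M} (hg : Function.Bijective g)
    (h : FactorsThroughProjective S (f.comp g)) : FactorsThroughProjective S f := by
  let e := LinearEquiv.ofBijective g hg
  have := h.comp_right e.symm.toLinearMap
  convert this
  ext x
  have : g (e.symm x) = x := e.apply_symm_apply x
  simp [this]

variable {S : Type u} [CommRing S] [IsLocalRing S] {M : Type u} [AddCommGroup M] [Module S M]

/-- An indecomposable module with a linear form not taking values in the maximal ideal is free
of rank one. -/
theorem IsIndecomposable.mem_maximalIdeal (hM : IsIndecomposable S M)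
    (hfree : IsEmpty (M ≃ₗ[S] S)) (φ : M →ₗ[S] S) (x : M) : φ x ∈ maximalIdeal S := by
  by_contra hx
  have hu : IsUnit (φ x) := by
    by_contra h
    exact hx h
  obtain ⟨y, hy⟩ : ∃ y, φ y = 1 := by
    obtain ⟨v, hv⟩ := hu.exists_left_inv
    exact ⟨v • x, by simpa using hv⟩
  have he : IsIdempotentElem (LinearMap.toSpanSingleton S M y ∘ₗ φ : Module.End S M) := by
    ext z
    simp [hy]
  rcases hM.eq_zero_or_eq_one he with h | h
  · have h1 := LinearMap.congr_fun h y
    simp only [LinearMap.comp_apply, hy, LinearMap.toSpanSingleton_apply, one_smul,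
      LinearMap.zero_apply] at h1
    rw [h1, map_zero] at hy
    exact zero_ne_one hy
  · refine hfree.false (LinearEquiv.ofLinearMap φ (LinearMap.toSpanSingleton S M y) ?_ h)
    ext
    simp [hy]

theorem FactorsThroughProjective.exists_lift_mem [Module.Finite S M] {N : Type u} [AddCommGroup N]
    [Module S N] (hN : ∀ (φ : N →ₗ[S] S) (x : N), φ x ∈ maximalIdeal S) {f : N →ₗ[S] M}
    (hf : FactorsThroughProjective S f) (x : N) :
    f x ∈ (maximalIdeal S • ⊤ : Submodule S M) := by
  obtain ⟨s, rfl⟩ := hf.exists_lift (Finsupp.linearCombination_id_surjective S M)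
  rw [LinearMap.comp_apply, Finsupp.linearCombination_apply, Finsupp.sum]
  exact Submodule.sum_mem _ fun i _ =>
    Submodule.smul_mem_smul (hN ((Finsupp.lapply i).comp s) x) Submodule.mem_top

theorem surjective_of_id_sub_mem [Module.Finite S M] {g : M →ₗ[S] M}
    (hg : ∀ x, x - g x ∈ (maximalIdeal S • ⊤ : Submodule S M)) : Function.Surjective g := by
  rw [← LinearMap.range_eq_top, ← top_le_iff]
  refine Submodule.le_of_le_smul_of_le_jacobson_bot (I := maximalIdeal S) Module.Finite.fg_top
    (IsLocalRing.maximalIdeal_le_jacobson ⊥) ?_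
  intro x _
  rw [← sub_add_cancel x (g x), add_comm]
  exact Submodule.add_mem_sup ⟨x, rfl⟩ (hg x)

theorem exists_idempotent_of_mem [IsNoetherianRing S] [IsAdicComplete (maximalIdeal S) S]
    [Module.Finite S M] (a : Module.End S M)
    (ha : ∀ x, a (a x) - a x ∈ (maximalIdeal S • ⊤ : Submodule S M)) :
    ∃ ε : Module.End S M, IsIdempotentElem ε ∧
      ∀ x, a x - ε x ∈ (maximalIdeal S • ⊤ : Submodule S M) := by
  have : IsPrecomplete (maximalIdeal S) M := isPrecomplete_of_finite _ _
  let m := maximalIdeal S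
  let q : ℕ → Module.End S M := fun n => (fun b => 3 * b ^ 2 - 2 * b ^ 3)^[n] a
  have hq0 : q 0 = a := rfl
  have hqs : ∀ n, q (n + 1) = 3 * q n ^ 2 - 2 * q n ^ 3 := fun n =>
    Function.iterate_succ_apply' _ _ _
  have hsmul : ∀ (f : Module.End S M) (I : Ideal S) (x : M), x ∈ (I • ⊤ : Submodule S M) →
      f x ∈ (I • LinearMap.range f : Submodule S M) := by
    intro f I x hx
    rw [LinearMap.range_eq_map, ← Submodule.map_smul'']
    exact Submodule.mem_map_of_mem hx
  have hsmul' : ∀ (f : Module.End S M) (I : Ideal S) (x : M), x ∈ (I • ⊤ : Submodule S M) →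
      f x ∈ (I • ⊤ : Submodule S M) := fun f I x hx =>
    Submodule.smul_mono (le_refl I) le_top (hsmul f I x hx)
  have he : ∀ n, LinearMap.range (q n ^ 2 - q n) ≤ m ^ (n + 1) • ⊤ := by
    intro n
    induction n with
    | zero =>
      rintro _ ⟨x, rfl⟩
      simpa [hq0, pow_two] using ha x
    | succ n ih =>
      have h1 : q (n + 1) ^ 2 - q (n + 1) =
          (q n ^ 2 - q n) * ((q n ^ 2 - q n) * (4 * q n ^ 2 - 4 * q n - 3)) := by
        rw [hqs]
        noncomm_ring
      rintro _ ⟨x, rfl⟩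
      rw [h1, Module.End.mul_apply, Module.End.mul_apply]
      have h2 := hsmul (q n ^ 2 - q n) _ _ (ih ⟨(4 * q n ^ 2 - 4 * q n - 3 : Module.End S M) x, rfl⟩)
      have h3 := Submodule.smul_mono (le_refl (m ^ (n + 1))) ih h2
      rw [← Submodule.mul_smul, ← pow_add] at h3
      exact Submodule.smul_mono_left (Ideal.pow_le_pow_right (by omega)) h3
  have hd : ∀ n x, q (n + 1) x - q n x ∈ (m ^ (n + 1) • ⊤ : Submodule S M) := by
    intro n x
    have h1 : q (n + 1) - q n = (q n ^ 2 - q n) * (1 - 2 * q n) := by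
      rw [hqs]
      noncomm_ring
    rw [← LinearMap.sub_apply, h1]
    exact he n ⟨_, rfl⟩
  have hle : ∀ n, (m ^ (n + 1) • ⊤ : Submodule S M) ≤ m ^ n • ⊤ := fun n =>
    Submodule.smul_mono_left (Ideal.pow_le_pow_right (by omega))
  obtain ⟨ε, hε⟩ := exists_linearMap_limit m q fun n x => hle n (hd n x)
  refine ⟨ε, ?_, fun x => ?_⟩
  · refine LinearMap.ext fun x => ?_
    rw [IsHausdorff.eq_iff_smodEq (I := m)]
    intro n
    rw [SModEq.sub_mem, Module.End.mul_apply]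
    have h1 := hε n (ε x)
    have h2 := hε n x
    have h3 := hsmul' (q n) _ _ h2
    have h4 := hle n (he n ⟨x, rfl⟩)
    have h5 : ε (ε x) - ε x = -(q n (ε x) - ε (ε x)) - q n (q n x - ε x) +
        (q n ^ 2 - q n) x + (q n x - ε x) := by
      rw [map_sub, LinearMap.sub_apply, pow_two, Module.End.mul_apply]
      abel
    rw [h5]
    exact add_mem (add_mem (sub_mem (neg_mem h1) h3) h4) h2
  · have h1 := hε 1 x
    have h2 := hd 0 x
    rw [hq0] at h2
    rw [pow_one] at h1
    rw [zero_add, pow_one] at h2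
    have : a x - ε x = (q 1 x - ε x) - (q (0 + 1) x - a x) := by
      rw [zero_add]
      abel
    rw [this]
    exact sub_mem h1 h2

theorem IsIndecomposable.factorsThroughProjective [IsNoetherianRing S]
    [IsAdicComplete (maximalIdeal S) S] [Module.Finite S M] (hM : IsIndecomposable S M)
    (hmax : ∀ (φ : M →ₗ[S] S) (x : M), φ x ∈ maximalIdeal S) {a : M →ₗ[S] M}
    (ha : FactorsThroughProjective S (a.comp a - a)) :
    FactorsThroughProjective S a ∨ FactorsThroughProjective S (LinearMap.id - a) := by
  obtain ⟨ε, hε, haε⟩ := exists_idempotent_of_mem a fun x => ha.exists_lift_mem hmax x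
  have hna : FactorsThroughProjective S (a - a.comp a) := by
    have := ha.smul (-1)
    rwa [neg_smul, one_smul, neg_sub] at this
  rcases hM.eq_zero_or_eq_one hε with rfl | rfl
  · left
    refine FactorsThroughProjective.of_comp_bijective (g := LinearMap.id - a)
      (OrzechProperty.bijective_of_surjective_endomorphism _ (surjective_of_id_sub_mem fun x => ?_)) ?_
    · simpa using haε x
    · convert hna using 1
      ext x
      simp
  · right
    refine FactorsThroughProjective.of_comp_bijective (g := a)
      (OrzechProperty.bijective_of_surjective_endomorphism _ (surjective_of_id_sub_mem fun x => ?_)) ?_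
    · rw [← neg_sub]
      exact neg_mem (haε x)
    · convert hna using 1
      ext x
      simp

end Indecomposable

section PowerSeriesModules

open PowerSeries

variable {R : Type u} [CommRing R]

/-- The vector of `j`-th coefficients of a vector of power series. -/
def coeffs (n j : ℕ) : (Fin n → R⟦X⟧) →ₗ[R] (Fin n → R) :=
  (coeff (R := R) j).compLeft (Fin n)

/-- Constant vectors of power series. -/
def consts (n : ℕ) : (Fin n → R) →ₗ[R] (Fin n → R⟦X⟧) :=
  (Algebra.linearMap R R⟦X⟧).compLeft (Fin n)

/-- The vectors of power series obtained by deleting the constant coefficients and dividing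
by `X`. -/
def shiftVec {n : ℕ} (x : Fin n → R⟦X⟧) : Fin n → R⟦X⟧ :=
  fun i => PowerSeries.mk fun p => coeff (p + 1) (x i)

theorem coeffs_apply {n : ℕ} (j : ℕ) (x : Fin n → R⟦X⟧) (i : Fin n) :
    coeffs n j x i = coeff j (x i) := rfl

theorem consts_apply {n : ℕ} (v : Fin n → R) (i : Fin n) :
    consts n v i = C (v i) := rfl

@[simp]
theorem coeffs_zero_consts {n : ℕ} (v : Fin n → R) : coeffs n 0 (consts n v) = v := by
  ext i
  simp [coeffs_apply, consts_apply]

@[simp]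
theorem coeffs_succ_consts {n : ℕ} (j : ℕ) (v : Fin n → R) :
    coeffs n (j + 1) (consts n v) = 0 := by
  ext i
  simp [coeffs_apply, consts_apply]

@[simp]
theorem coeffs_zero_X_smul {n : ℕ} (x : Fin n → R⟦X⟧) :
    coeffs n 0 ((X : R⟦X⟧) • x) = 0 := by
  ext i
  simp [coeffs_apply]

@[simp]
theorem coeffs_succ_X_smul {n : ℕ} (j : ℕ) (x : Fin n → R⟦X⟧) :
    coeffs n (j + 1) ((X : R⟦X⟧) • x) = coeffs n j x := by
  ext i
  simp [coeffs_apply, coeff_succ_X_mul]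

theorem coeffs_zero_smul {n : ℕ} (a : R⟦X⟧) (x : Fin n → R⟦X⟧) :
    coeffs n 0 (a • x) = constantCoeff a • coeffs n 0 x := by
  ext i
  simp [coeffs_apply]

@[simp]
theorem coeffs_shiftVec {n : ℕ} (j : ℕ) (x : Fin n → R⟦X⟧) :
    coeffs n j (shiftVec x) = coeffs n (j + 1) x := by
  ext i
  simp [coeffs_apply, shiftVec]

theorem eq_consts_add_shiftVec {n : ℕ} (x : Fin n → R⟦X⟧) :
    x = consts n (coeffs n 0 x) + (X : R⟦X⟧) • shiftVec x := by
  ext1 i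
  have := eq_X_mul_shift_add_const (x i)
  simp only [Pi.add_apply, Pi.smul_apply, consts_apply, coeffs_apply, shiftVec, smul_eq_mul,
    coeff_zero_eq_constantCoeff]
  rw [add_comm]
  exact this

theorem coeffs_zero_map {n n' : ℕ} (g : (Fin n → R⟦X⟧) →ₗ[R⟦X⟧] (Fin n' → R⟦X⟧))
    (x : Fin n → R⟦X⟧) : coeffs n' 0 (g x) = coeffs n' 0 (g (consts n (coeffs n 0 x))) := by
  conv_lhs => rw [eq_consts_add_shiftVec x]
  rw [map_add, map_smul, map_add, coeffs_zero_X_smul, add_zero]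

theorem coeffs_one_map {n n' : ℕ} (g : (Fin n → R⟦X⟧) →ₗ[R⟦X⟧] (Fin n' → R⟦X⟧))
    (x : Fin n → R⟦X⟧) : coeffs n' 1 (g x) = coeffs n' 1 (g (consts n (coeffs n 0 x))) +
      coeffs n' 0 (g (consts n (coeffs n 1 x))) := by
  conv_lhs => rw [eq_consts_add_shiftVec x]
  rw [map_add, map_smul, map_add, coeffs_succ_X_smul, coeffs_zero_map g (shiftVec x),
    coeffs_shiftVec]

theorem coeffs_two_map {n n' : ℕ} (g : (Fin n → R⟦X⟧) →ₗ[R⟦X⟧] (Fin n' → R⟦X⟧))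
    (x : Fin n → R⟦X⟧) : coeffs n' 2 (g x) = coeffs n' 2 (g (consts n (coeffs n 0 x))) +
      (coeffs n' 1 (g (consts n (coeffs n 1 x))) +
        coeffs n' 0 (g (consts n (coeffs n 2 x)))) := by
  conv_lhs => rw [eq_consts_add_shiftVec x]
  rw [map_add, map_smul, map_add, coeffs_succ_X_smul, coeffs_one_map g (shiftVec x),
    coeffs_shiftVec, coeffs_shiftVec]

/-- The vectors of power series whose vector of constant coefficients lies in `K`. -/
def liftSubmodule {n : ℕ} (K : Submodule R (Fin n → R)) : Submodule R⟦X⟧ (Fin n → R⟦X⟧) where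
  carrier := {x | coeffs n 0 x ∈ K}
  add_mem' := fun hx hy => by
    change coeffs n 0 (_ + _) ∈ K
    rw [map_add]
    exact K.add_mem hx hy
  zero_mem' := by simp
  smul_mem' := fun a x hx => by
    change coeffs n 0 (a • x) ∈ K
    rw [coeffs_zero_smul]
    exact K.smul_mem _ hx

theorem mem_liftSubmodule {n : ℕ} {K : Submodule R (Fin n → R)} {x : Fin n → R⟦X⟧} :
    x ∈ liftSubmodule K ↔ coeffs n 0 x ∈ K := Iff.rfl

/-- Multiplication by `X` as a map into `liftSubmodule K`. -/
def mulXMap {n : ℕ} (K : Submodule R (Fin n → R)) :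
    (Fin n → R⟦X⟧) →ₗ[R⟦X⟧] liftSubmodule K :=
  LinearMap.codRestrict _ ((X : R⟦X⟧) • LinearMap.id) fun x => by
    simp [mem_liftSubmodule]

/-- The constant vectors in `liftSubmodule K`. -/
def constMap {n : ℕ} (K : Submodule R (Fin n → R)) : K →ₗ[R] liftSubmodule K where
  toFun k := ⟨consts n k, by simp [mem_liftSubmodule]⟩
  map_add' _ _ := Subtype.ext (by simp)
  map_smul' _ _ := Subtype.ext (by simp)

variable {n n' n'' : ℕ} {K : Submodule R (Fin n → R)} {K' : Submodule R (Fin n' → R)}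
  {K'' : Submodule R (Fin n'' → R)}

theorem coe_mulXMap (x : Fin n → R⟦X⟧) : (mulXMap K x : Fin n → R⟦X⟧) = (X : R⟦X⟧) • x := rfl

theorem coe_constMap (k : K) : (constMap K k : Fin n → R⟦X⟧) = consts n k := rfl

theorem mulXMap_coe (x : liftSubmodule K) : mulXMap K x = (X : R⟦X⟧) • x := rfl

theorem eq_constMap_add_mulXMap (x : liftSubmodule K) :
    x = constMap K ⟨coeffs n 0 x, x.2⟩ + mulXMap K (shiftVec (x : Fin n → R⟦X⟧)) :=
  Subtype.ext (eq_consts_add_shiftVec _)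

/-- The linear map sending `v` to the `j`-th coefficients of `f (X • v)`. -/
def coeffMap (j : ℕ) (f : liftSubmodule K →ₗ[R⟦X⟧] (Fin n' → R⟦X⟧)) :
    (Fin n → R) →ₗ[R] (Fin n' → R) :=
  (coeffs n' j).comp (((f.comp (mulXMap K)).restrictScalars R).comp (consts n))

theorem coeffMap_apply (j : ℕ) (f : liftSubmodule K →ₗ[R⟦X⟧] (Fin n' → R⟦X⟧)) (v : Fin n → R) :
    coeffMap j f v = coeffs n' j (f.comp (mulXMap K) (consts n v)) := rfl

theorem coeffs_eq_succ (f : liftSubmodule K →ₗ[R⟦X⟧] (Fin n' → R⟦X⟧)) (j : ℕ)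
    (x : liftSubmodule K) :
    coeffs n' j (f x) = coeffs n' (j + 1) (f.comp (mulXMap K) (x : Fin n → R⟦X⟧)) := by
  rw [LinearMap.comp_apply, mulXMap_coe, map_smul, coeffs_succ_X_smul]

theorem coeffs_zero_apply (f : liftSubmodule K →ₗ[R⟦X⟧] (Fin n' → R⟦X⟧)) (x : liftSubmodule K) :
    coeffs n' 0 (f x) =
      coeffMap 1 f (coeffs n 0 (x : Fin n → R⟦X⟧)) +
        coeffMap 0 f (coeffs n 1 (x : Fin n → R⟦X⟧)) := by
  rw [coeffs_eq_succ, coeffs_one_map]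
  rfl

theorem coeffs_one_apply (f : liftSubmodule K →ₗ[R⟦X⟧] (Fin n' → R⟦X⟧)) (x : liftSubmodule K) :
    coeffs n' 1 (f x) =
      coeffMap 2 f (coeffs n 0 (x : Fin n → R⟦X⟧)) +
        (coeffMap 1 f (coeffs n 1 (x : Fin n → R⟦X⟧)) +
          coeffMap 0 f (coeffs n 2 (x : Fin n → R⟦X⟧))) := by
  rw [coeffs_eq_succ, coeffs_two_map]
  rfl

theorem coeffMap_zero_of_mem (f : liftSubmodule K →ₗ[R⟦X⟧] (Fin n' → R⟦X⟧)) {k : Fin n → R}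
    (hk : k ∈ K) : coeffMap 0 f k = 0 := by
  have h : mulXMap K (consts n k) = (X : R⟦X⟧) • constMap K ⟨k, hk⟩ := rfl
  rw [coeffMap_apply, LinearMap.comp_apply, h, map_smul, coeffs_zero_X_smul]

theorem coeffMap_one_of_mem (f : liftSubmodule K →ₗ[R⟦X⟧] (Fin n' → R⟦X⟧)) {k : Fin n → R}
    (hk : k ∈ K) : coeffMap 1 f k = coeffs n' 0 (f (constMap K ⟨k, hk⟩)) := by
  rw [coeffs_zero_apply, coe_constMap, coeffs_zero_consts, coeffs_succ_consts, map_zero, add_zero]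

/-- The variant of `coeffMap` for maps between lifted submodules. -/
def coeffMapOf (j : ℕ) (f : liftSubmodule K →ₗ[R⟦X⟧] liftSubmodule K') :
    (Fin n → R) →ₗ[R] (Fin n' → R) :=
  coeffMap j ((liftSubmodule K').subtype.comp f)

theorem coeffMapOf_zero_mem (f : liftSubmodule K →ₗ[R⟦X⟧] liftSubmodule K') (v : Fin n → R) :
    coeffMapOf 0 f v ∈ K' := (f (mulXMap K (consts n v))).2

theorem coeffMapOf_one_mem (f : liftSubmodule K →ₗ[R⟦X⟧] liftSubmodule K') {k : Fin n → R}
    (hk : k ∈ K) : coeffMapOf 1 f k ∈ K' := by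
  rw [coeffMapOf, coeffMap_one_of_mem _ hk]
  exact (f (constMap K ⟨k, hk⟩)).2

/-- A linear map on the source of a surjection, descended to the target. -/
def descend {F M N : Type u} [AddCommGroup F] [Module R F] [AddCommGroup M] [Module R M]
    [AddCommGroup N] [Module R N] {π : F →ₗ[R] M} (hπ : Function.Surjective π) (w : F →ₗ[R] N)
    (h : LinearMap.ker π ≤ LinearMap.ker w) : M →ₗ[R] N :=
  ((LinearMap.ker π).liftQ w h).comp (π.quotKerEquivOfSurjective hπ).symm.toLinearMap

theorem descend_apply {F M N : Type u} [AddCommGroup F] [Module R F] [AddCommGroup M]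
    [Module R M] [AddCommGroup N] [Module R N] {π : F →ₗ[R] M} (hπ : Function.Surjective π)
    (w : F →ₗ[R] N) (h : LinearMap.ker π ≤ LinearMap.ker w) (v : F) :
    descend hπ w h (π v) = w v := by
  have : (π.quotKerEquivOfSurjective hπ).symm (π v) = Submodule.Quotient.mk v := by
    rw [LinearEquiv.symm_apply_eq]
    rfl
  simp only [descend, LinearMap.comp_apply, LinearEquiv.coe_coe, this]
  rfl

variable {M M' M'' : Type u} [AddCommGroup M] [Module R M] [AddCommGroup M'] [Module R M']
  [AddCommGroup M''] [Module R M''] {π : (Fin n → R) →ₗ[R] M} {π' : (Fin n' → R) →ₗ[R] M'}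
  {π'' : (Fin n'' → R) →ₗ[R] M''}

/-- The map induced on the presented modules by a map between the lifts of their relation
modules. -/
def inducedMap (hπ : Function.Surjective π) (π' : (Fin n' → R) →ₗ[R] M')
    (f : liftSubmodule (LinearMap.ker π) →ₗ[R⟦X⟧] liftSubmodule (LinearMap.ker π')) :
    M →ₗ[R] M' :=
  descend hπ (π'.comp (coeffMapOf 1 f)) fun _ hk => coeffMapOf_one_mem f hk

theorem inducedMap_apply (hπ : Function.Surjective π)
    (f : liftSubmodule (LinearMap.ker π) →ₗ[R⟦X⟧] liftSubmodule (LinearMap.ker π'))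
    (v : Fin n → R) : inducedMap hπ π' f (π v) = π' (coeffMapOf 1 f v) :=
  descend_apply _ _ _ _

theorem inducedMap_ext (hπ : Function.Surjective π) {φ ψ : M →ₗ[R] M'}
    (h : ∀ v, φ (π v) = ψ (π v)) : φ = ψ := by
  ext x
  obtain ⟨v, rfl⟩ := hπ x
  exact h v

theorem inducedMap_id (hπ : Function.Surjective π) :
    inducedMap hπ π LinearMap.id = LinearMap.id := by
  refine inducedMap_ext hπ fun v => ?_
  rw [inducedMap_apply]
  have : coeffMapOf 1 (LinearMap.id : liftSubmodule (LinearMap.ker π) →ₗ[R⟦X⟧] _) v = v := by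
    change coeffs n 1 ((X : R⟦X⟧) • consts n v) = v
    rw [coeffs_succ_X_smul, coeffs_zero_consts]
  rw [this, LinearMap.id_apply]

theorem inducedMap_sub (hπ : Function.Surjective π)
    (f g : liftSubmodule (LinearMap.ker π) →ₗ[R⟦X⟧] liftSubmodule (LinearMap.ker π')) :
    inducedMap hπ π' (f - g) = inducedMap hπ π' f - inducedMap hπ π' g := by
  refine inducedMap_ext hπ fun v => ?_
  rw [LinearMap.sub_apply, inducedMap_apply, inducedMap_apply, inducedMap_apply, ← map_sub]
  rfl

theorem inducedMap_smul (hπ : Function.Surjective π) (r : R)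
    (f : liftSubmodule (LinearMap.ker π) →ₗ[R⟦X⟧] liftSubmodule (LinearMap.ker π')) :
    inducedMap hπ π' (C r • f) = r • inducedMap hπ π' f := by
  refine inducedMap_ext hπ fun v => ?_
  rw [LinearMap.smul_apply, inducedMap_apply, inducedMap_apply, ← map_smul]
  congr 1
  ext i
  exact coeff_C_mul _ _ _

theorem inducedMap_comp (hπ : Function.Surjective π) (hπ' : Function.Surjective π')
    (f : liftSubmodule (LinearMap.ker π) →ₗ[R⟦X⟧] liftSubmodule (LinearMap.ker π'))
    (g : liftSubmodule (LinearMap.ker π') →ₗ[R⟦X⟧] liftSubmodule (LinearMap.ker π'')) :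
    FactorsThroughProjective R (inducedMap hπ π'' (g.comp f) -
      (inducedMap hπ' π'' g).comp (inducedMap hπ π' f)) := by
  let s : M →ₗ[R] (Fin n' → R) :=
    descend hπ (coeffMapOf 0 f) fun _ hk => coeffMap_zero_of_mem _ hk
  have : inducedMap hπ π'' (g.comp f) - (inducedMap hπ' π'' g).comp (inducedMap hπ π' f) =
      (π''.comp (coeffMapOf 2 g)).comp s := by
    refine inducedMap_ext hπ fun v => ?_
    have h1 : coeffMapOf 1 (g.comp f) v = coeffMapOf 2 g (coeffMapOf 0 f v) +
        (coeffMapOf 1 g (coeffMapOf 1 f v) + coeffMapOf 0 g (coeffMapOf 2 f v)) :=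
      coeffs_one_apply ((liftSubmodule _).subtype.comp g) (f (mulXMap _ (consts n v)))
    have h2 : π'' (coeffMapOf 0 g (coeffMapOf 2 f v)) = 0 := coeffMapOf_zero_mem g _
    have hs : s (π v) = coeffMapOf 0 f v := descend_apply _ _ _ _
    rw [LinearMap.sub_apply, LinearMap.comp_apply, inducedMap_apply,
      inducedMap_apply, inducedMap_apply, h1, LinearMap.comp_apply, hs, map_add, map_add, h2]
    abel
  rw [this]
  exact FactorsThroughProjective.of_projective _ _

theorem inducedMap_factorsThroughProjective (hπ : Function.Surjective π)
    [Module.Finite R⟦X⟧ (liftSubmodule (LinearMap.ker π'))]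
    {f : liftSubmodule (LinearMap.ker π) →ₗ[R⟦X⟧] liftSubmodule (LinearMap.ker π')}
    (hf : FactorsThroughProjective R⟦X⟧ f) :
    FactorsThroughProjective R (inducedMap hπ π' f) := by
  obtain ⟨m, p, hp⟩ := Module.Finite.exists_fin' R⟦X⟧ (liftSubmodule (LinearMap.ker π'))
  obtain ⟨s, rfl⟩ := hf.exists_lift hp
  let ρ : (Fin m → R) →ₗ[R] PUnit.{u + 1} := 0
  have hρ : Function.Surjective ρ := fun _ => ⟨0, rfl⟩
  let s' : liftSubmodule (LinearMap.ker π) →ₗ[R⟦X⟧] liftSubmodule (LinearMap.ker ρ) :=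
    LinearMap.codRestrict _ s fun _ => rfl
  let p' : liftSubmodule (LinearMap.ker ρ) →ₗ[R⟦X⟧] liftSubmodule (LinearMap.ker π') :=
    p.comp (liftSubmodule (LinearMap.ker ρ)).subtype
  have h := inducedMap_comp hπ hρ s' p'
  have h0 : (inducedMap hρ π' p').comp (inducedMap hπ ρ s') = 0 := by
    ext x
    rw [LinearMap.comp_apply, Subsingleton.elim (inducedMap hπ ρ s' x) 0, map_zero,
      LinearMap.zero_apply]
  rwa [h0, sub_zero] at h

end PowerSeriesModules

section PowerSeriesLattices

open PowerSeries

variable {R : Type u} [CommRing R]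

theorem mem_smul_top_of_mem (I : Ideal R) {F F' : Type u} [AddCommGroup F] [Module R F]
    [AddCommGroup F'] [Module R F'] (g : F →ₗ[R] F') {v : F} (hv : v ∈ (I • ⊤ : Submodule R F)) :
    g v ∈ (I • ⊤ : Submodule R F') :=
  Submodule.smul_top_le_comap_smul_top I g hv

theorem mem_ideal_of_mem_smul_top (I : Ideal R) {F : Type u} [AddCommGroup F] [Module R F]
    (g : F →ₗ[R] R) {v : F} (hv : v ∈ (I • ⊤ : Submodule R F)) : g v ∈ I := by
  have := mem_smul_top_of_mem I g hv
  rwa [smul_eq_mul, Ideal.mul_top] at this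

theorem liftSubmodule_exists_surjective {n m : ℕ} {K : Submodule R (Fin n → R)}
    {p : (Fin m → R) →ₗ[R] K} (hp : Function.Surjective p) :
    ∃ f : (Fin (m + n) → R⟦X⟧) →ₗ[R⟦X⟧] liftSubmodule K, Function.Surjective f := by
  let w : Fin m ⊕ Fin n → liftSubmodule K :=
    Sum.elim (fun i => constMap K (p (Pi.single i 1))) fun j => mulXMap K (Pi.single j 1)
  let q := Fintype.linearCombination R⟦X⟧ w
  have hq : Function.Surjective q := by
    rw [← LinearMap.range_eq_top, Fintype.range_linearCombination, eq_top_iff]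
    rintro x -
    rw [eq_constMap_add_mulXMap x]
    refine add_mem ?_ ?_
    · obtain ⟨v, hv⟩ := hp ⟨coeffs n 0 x, x.2⟩
      rw [← hv, ← LinearMap.comp_apply, LinearMap.pi_apply_eq_sum_univ]
      refine sum_mem fun i _ => Submodule.smul_of_tower_mem _ _ (Submodule.subset_span ⟨.inl i, ?_⟩)
      simp only [w, Sum.elim_inl, LinearMap.comp_apply]
      congr 2
      ext j
      simp [Pi.single_apply, eq_comm]
    · rw [LinearMap.pi_apply_eq_sum_univ (mulXMap K)]
      refine sum_mem fun i _ => Submodule.smul_mem _ _ (Submodule.subset_span ⟨.inr i, ?_⟩)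
      simp only [w, Sum.elim_inr]
      congr 1
      ext j : 1
      simp [Pi.single_apply, eq_comm]
  exact ⟨q.comp (LinearEquiv.funCongrLeft R⟦X⟧ R⟦X⟧ finSumFinEquiv).toLinearMap,
    hq.comp (LinearEquiv.surjective _)⟩

variable {n : ℕ} {K : Submodule R (Fin n → R)} {M : Type u} [AddCommGroup M] [Module R M]
  {π : (Fin n → R) →ₗ[R] M}

instance liftSubmodule_finite [IsNoetherianRing R] :
    Module.Finite R⟦X⟧ (liftSubmodule K) :=
  inferInstance

theorem liftSubmodule_nontrivial [Nontrivial R] (hn : 0 < n) : Nontrivial (liftSubmodule K) := by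
  refine ⟨mulXMap K (consts n fun _ => 1), 0, fun h => ?_⟩
  have h1 := congrArg (fun x : liftSubmodule K => coeffs n 1 (x : Fin n → R⟦X⟧) ⟨0, hn⟩) h
  simp [coe_mulXMap] at h1

theorem mulXMap_factorsThroughProjective :
    FactorsThroughProjective R⟦X⟧
      ((X : R⟦X⟧) • (LinearMap.id : liftSubmodule K →ₗ[R⟦X⟧] liftSubmodule K)) :=
  FactorsThroughProjective.of_projective (liftSubmodule K).subtype (mulXMap K)

theorem C_smul_factorsThroughProjective (hπ : Function.Surjective π) {r : R}
    (hr : FactorsThroughProjective R (r • (LinearMap.id : M →ₗ[R] M))) :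
    FactorsThroughProjective R⟦X⟧ (C r • (LinearMap.id :
      liftSubmodule (LinearMap.ker π) →ₗ[R⟦X⟧] liftSubmodule (LinearMap.ker π))) := by
  obtain ⟨s, hs⟩ := hr.exists_lift hπ
  obtain ⟨A, hA⟩ := Matrix.toLin'.surjective (s.comp π)
  let σ : (Fin n → R⟦X⟧) →ₗ[R⟦X⟧] (Fin n → R⟦X⟧) := Matrix.toLin' (A.map C)
  have hσ : ∀ x, coeffs n 0 (σ x) = s (π (coeffs n 0 x)) := by
    intro x
    rw [← LinearMap.comp_apply s π, ← hA]
    ext i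
    simp [σ, coeffs_apply, Matrix.mulVec, dotProduct]
  have hs' : ∀ m, π (s m) = r • m := fun m => LinearMap.congr_fun hs m
  let g : (Fin n → R⟦X⟧) →ₗ[R⟦X⟧] liftSubmodule (LinearMap.ker π) :=
    LinearMap.codRestrict _ (C r • LinearMap.id - σ) fun x => by
      rw [mem_liftSubmodule, LinearMap.sub_apply, map_sub, hσ, LinearMap.smul_apply,
        LinearMap.id_apply, coeffs_zero_smul, LinearMap.mem_ker, map_sub, map_smul, hs']
      simp
  have hX : IsSMulRegular (Fin n → R⟦X⟧) (X : R⟦X⟧) := by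
    intro x y hxy
    ext1 i
    exact X_mul_cancel (congrFun hxy i)
  obtain ⟨h, hh⟩ := exists_smul_eq_of_range_le hX
    (σ.comp (liftSubmodule (LinearMap.ker π)).subtype) fun z => by
      rw [LinearMap.comp_apply, eq_consts_add_shiftVec (σ _), hσ]
      rw [show π (coeffs n 0 ((liftSubmodule (LinearMap.ker π)).subtype z)) = 0 from z.2,
        map_zero, map_zero, zero_add]
      exact Submodule.smul_mem_pointwise_smul _ _ _ trivial
  have : C r • (LinearMap.id : liftSubmodule (LinearMap.ker π) →ₗ[R⟦X⟧] _) =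
      g.comp (liftSubmodule (LinearMap.ker π)).subtype + (mulXMap _).comp h := by
    ext1 x
    apply Subtype.ext
    have h1 : σ x = (X : R⟦X⟧) • h x := LinearMap.congr_fun hh x
    change C r • (x : Fin n → R⟦X⟧) = (C r • (x : Fin n → R⟦X⟧) - σ x) + (X : R⟦X⟧) • h x
    rw [h1, sub_add_cancel]
  rw [this]
  exact (FactorsThroughProjective.of_projective _ _).add
    (FactorsThroughProjective.of_projective _ _)

section Local

variable [IsLocalRing R]

theorem mem_maximalIdeal_powerSeries {a : R⟦X⟧} :
    a ∈ maximalIdeal R⟦X⟧ ↔ constantCoeff a ∈ maximalIdeal R := by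
  rw [mem_maximalIdeal, mem_maximalIdeal, mem_nonunits_iff, mem_nonunits_iff,
    isUnit_iff_constantCoeff]

theorem constantCoeff_mem_pow {c : ℕ} {a : R⟦X⟧} (ha : a ∈ maximalIdeal R⟦X⟧ ^ c) :
    constantCoeff a ∈ maximalIdeal R ^ c := by
  have h : (maximalIdeal R⟦X⟧).map (constantCoeff (R := R)) ≤ maximalIdeal R :=
    Ideal.map_le_iff_le_comap.2 fun a ha => mem_maximalIdeal_powerSeries.1 ha
  have := Ideal.mem_map_of_mem (constantCoeff (R := R)) ha
  rw [Ideal.map_pow] at this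
  exact Ideal.pow_right_mono h c this

theorem X_mem_maximalIdeal : (X : R⟦X⟧) ∈ maximalIdeal R⟦X⟧ :=
  mem_maximalIdeal_powerSeries.2 (by simp)

theorem C_mem_maximalIdeal_pow {c : ℕ} {r : R} (hr : r ∈ maximalIdeal R ^ c) :
    C r ∈ maximalIdeal R⟦X⟧ ^ c := by
  have h : (maximalIdeal R).map (C (R := R)) ≤ maximalIdeal R⟦X⟧ :=
    Ideal.map_le_iff_le_comap.2 fun a ha => mem_maximalIdeal_powerSeries.2 (by simpa using ha)
  have := Ideal.mem_map_of_mem (C (R := R)) hr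
  rw [Ideal.map_pow] at this
  exact Ideal.pow_right_mono h c this

theorem IsTame.liftSubmodule (hπ : Function.Surjective π) {c : ℕ} (hM : IsTame R c M) :
    IsTame R⟦X⟧ c (liftSubmodule (LinearMap.ker π)) := by
  intro a ha
  have h : a • (LinearMap.id : BT.liftSubmodule (LinearMap.ker π) →ₗ[R⟦X⟧] _) =
      (PowerSeries.mk fun p => coeff (p + 1) a) • ((X : R⟦X⟧) • LinearMap.id) +
        C (constantCoeff a) • LinearMap.id := by
    conv_lhs => rw [eq_X_mul_shift_add_const a, add_smul, mul_comm, mul_smul]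
  rw [h]
  exact (mulXMap_factorsThroughProjective.smul _).add
    (C_smul_factorsThroughProjective hπ (hM _ (constantCoeff_mem_pow ha)))

theorem IsTame.of_liftSubmodule [IsNoetherianRing R] (hπ : Function.Surjective π) {c : ℕ}
    (hN : IsTame R⟦X⟧ c (BT.liftSubmodule (LinearMap.ker π))) : IsTame R c M := by
  intro y hy
  have := inducedMap_factorsThroughProjective hπ (hN _ (C_mem_maximalIdeal_pow hy))
  rwa [inducedMap_smul, inducedMap_id] at this

theorem liftSubmodule_mem_maximalIdeal (hπ : Function.Surjective π)
    (hk : LinearMap.ker π ≤ maximalIdeal R • ⊤)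
    (hmax : ∀ (φ : M →ₗ[R] R) (x : M), φ x ∈ maximalIdeal R)
    (φ : liftSubmodule (LinearMap.ker π) →ₗ[R⟦X⟧] R⟦X⟧) (x : liftSubmodule (LinearMap.ker π)) :
    φ x ∈ maximalIdeal R⟦X⟧ := by
  rw [mem_maximalIdeal_powerSeries]
  let f : liftSubmodule (LinearMap.ker π) →ₗ[R⟦X⟧] (Fin 1 → R⟦X⟧) := LinearMap.pi fun _ => φ
  have h : constantCoeff (φ x) = coeffs 1 0 (f x) 0 := by
    simp [coeffs_apply, f]
  rw [h, coeffs_zero_apply]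
  let s : M →ₗ[R] (Fin 1 → R) :=
    descend hπ (coeffMap 0 f) fun _ hk => coeffMap_zero_of_mem _ hk
  have hs : s (π (coeffs n 1 x)) = coeffMap 0 f (coeffs n 1 x) := descend_apply _ _ _ _
  rw [← hs]
  exact add_mem (mem_ideal_of_mem_smul_top _ ((LinearMap.proj 0).comp (coeffMap 1 f)) (hk x.2))
    (hmax ((LinearMap.proj 0).comp s) _)

/-- An idempotent of the lift whose induced map is stably trivial vanishes. -/
theorem eq_zero_of_inducedMap_factorsThroughProjective [IsNoetherianRing R]
    (hπ : Function.Surjective π)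
    (hk : LinearMap.ker π ≤ maximalIdeal R • ⊤)
    (hmax : ∀ (φ : M →ₗ[R] R) (x : M), φ x ∈ maximalIdeal R)
    {e : Module.End R⟦X⟧ (liftSubmodule (LinearMap.ker π))} (he : IsIdempotentElem e)
    (h : FactorsThroughProjective R (inducedMap hπ π e)) : e = 0 := by
  obtain ⟨s, hs⟩ := h.exists_lift hπ
  have hsm : ∀ x, s x ∈ (maximalIdeal R • ⊤ : Submodule R (Fin n → R)) := by
    have : FactorsThroughProjective R s := ⟨_, _, _, inferInstance, s, LinearMap.id, rfl⟩
    exact this.exists_lift_mem hmax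
  have hD : ∀ v, coeffMapOf 1 e v - s (π v) ∈ LinearMap.ker π := fun v => by
    rw [LinearMap.mem_ker, map_sub, ← inducedMap_apply hπ e v, ← hs, LinearMap.comp_apply,
      sub_self]
  let δ : (Fin n → R) →ₗ[R] LinearMap.ker π :=
    LinearMap.codRestrict _ (coeffMapOf 1 e - s.comp π) hD
  let δ0 : (Fin n → R) →ₗ[R] LinearMap.ker π :=
    LinearMap.codRestrict _ (coeffMapOf 0 e) (coeffMapOf_zero_mem e)
  have h1 : ∀ x : liftSubmodule (LinearMap.ker π),
      coeffs n 1 (e x : Fin n → R⟦X⟧) ∈ (maximalIdeal R • ⊤ : Submodule R (Fin n → R)) := by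
    intro x
    rw [show coeffs n 1 (e x : Fin n → R⟦X⟧) = coeffMapOf 2 e (coeffs n 0 x) +
      (coeffMapOf 1 e (coeffs n 1 x) + coeffMapOf 0 e (coeffs n 2 x)) from
        coeffs_one_apply ((liftSubmodule _).subtype.comp e) x]
    refine add_mem (mem_smul_top_of_mem _ _ (hk x.2)) (add_mem ?_ (hk (coeffMapOf_zero_mem e _)))
    rw [← sub_add_cancel (coeffMapOf 1 e (coeffs n 1 x)) (s (π (coeffs n 1 x)))]
    exact add_mem (hk (hD _)) (hsm _)
  have h2 : ∀ z : liftSubmodule (LinearMap.ker π), e z = z →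
      z ∈ (maximalIdeal R⟦X⟧ • ⊤ : Submodule R⟦X⟧ (liftSubmodule (LinearMap.ker π))) := by
    intro z hz
    have hz1 : coeffs n 1 (z : Fin n → R⟦X⟧) ∈ (maximalIdeal R • ⊤ : Submodule R (Fin n → R)) := by
      rw [← hz]
      exact h1 z
    have hsum : (⟨coeffs n 0 z, z.2⟩ : LinearMap.ker π) =
        δ (coeffs n 0 z) + δ0 (coeffs n 1 z) := by
      apply Subtype.ext
      have : coeffs n 0 (e z : Fin n → R⟦X⟧) =
          coeffMapOf 1 e (coeffs n 0 z) + coeffMapOf 0 e (coeffs n 1 z) :=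
        coeffs_zero_apply ((liftSubmodule _).subtype.comp e) z
      rw [hz] at this
      have hπz : π (coeffs n 0 (z : Fin n → R⟦X⟧)) = 0 := z.2
      change coeffs n 0 (z : Fin n → R⟦X⟧) =
        (coeffMapOf 1 e (coeffs n 0 z) - s (π (coeffs n 0 z))) + coeffMapOf 0 e (coeffs n 1 z)
      rw [hπz, map_zero, sub_zero]
      exact this
    have hconst : ∀ k ∈ (maximalIdeal R • ⊤ : Submodule R (LinearMap.ker π)),
        constMap _ k ∈
          (maximalIdeal R⟦X⟧ • ⊤ : Submodule R⟦X⟧ (liftSubmodule (LinearMap.ker π))) := by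
      intro k hk
      induction hk using Submodule.smul_induction_on' with
      | smul r hr k _ =>
        have : constMap _ (r • k) = C r • constMap _ k := by
          apply Subtype.ext
          ext1 i
          simp [coe_constMap, consts_apply, smul_eq_C_mul]
        rw [this]
        exact Submodule.smul_mem_smul
          (by simpa using C_mem_maximalIdeal_pow (c := 1) (by simpa using hr)) trivial
      | add x _ y _ hx hy =>
        rw [map_add]
        exact add_mem hx hy
    have hmulX : ∀ v ∈ (maximalIdeal R • ⊤ : Submodule R (Fin n → R)),
        mulXMap _ (consts n v) ∈
          (maximalIdeal R⟦X⟧ • ⊤ : Submodule R⟦X⟧ (liftSubmodule (LinearMap.ker π))) := by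
      intro v hv
      induction hv using Submodule.smul_induction_on' with
      | smul r hr k _ =>
        have : mulXMap (LinearMap.ker π) (consts n (r • k)) = C r • mulXMap _ (consts n k) := by
          rw [← map_smul]
          congr 1
          ext1 i
          simp [consts_apply]
        rw [this]
        exact Submodule.smul_mem_smul
          (by simpa using C_mem_maximalIdeal_pow (c := 1) (by simpa using hr)) trivial
      | add x _ y _ hx hy =>
        rw [map_add, map_add]
        exact add_mem hx hy
    rw [eq_constMap_add_mulXMap z, hsum]
    refine add_mem (hconst _ (add_mem (mem_smul_top_of_mem _ _ (hk z.2))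
      (mem_smul_top_of_mem _ _ hz1))) ?_
    rw [eq_consts_add_shiftVec (shiftVec (z : Fin n → R⟦X⟧)), coeffs_shiftVec, map_add, map_smul]
    exact add_mem (hmulX _ hz1) (Submodule.smul_mem_smul X_mem_maximalIdeal trivial)
  have hee : ∀ x, e (e x) = e x := fun x => LinearMap.congr_fun he x
  have h3 : LinearMap.range e ≤ maximalIdeal R⟦X⟧ • LinearMap.range e := by
    rintro _ ⟨x, rfl⟩
    have := Submodule.mem_map_of_mem (f := e) (h2 (e x) (hee x))
    rwa [Submodule.map_smul'', Submodule.map_top, hee] at this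
  have h4 := Submodule.eq_bot_of_le_smul_of_le_jacobson_bot _ _ (IsNoetherian.noetherian _) h3
    (maximalIdeal_le_jacobson _)
  exact LinearMap.range_eq_bot.1 h4

theorem liftSubmodule_isIndecomposable [IsNoetherianRing R] [IsAdicComplete (maximalIdeal R) R]
    (hπ : Function.Surjective π) (hk : LinearMap.ker π ≤ maximalIdeal R • ⊤)
    (hmax : ∀ (φ : M →ₗ[R] R) (x : M), φ x ∈ maximalIdeal R) (hM : IsIndecomposable R M) :
    IsIndecomposable R⟦X⟧ (liftSubmodule (LinearMap.ker π)) := by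
  have hMn := hM.1
  have hn : 0 < n := by
    rcases Nat.eq_zero_or_pos n with rfl | h
    · have := hπ.subsingleton
      exact absurd hMn (not_nontrivial M)
    · exact h
  have := liftSubmodule_nontrivial (K := LinearMap.ker π) hn
  have := Module.Finite.of_surjective π hπ
  refine isIndecomposable_of_idempotent fun e he => ?_
  have h1 := inducedMap_comp hπ hπ e e (π'' := π)
  rw [show e.comp e = e from he] at h1
  have h2 : FactorsThroughProjective R ((inducedMap hπ π e).comp (inducedMap hπ π e) -
      inducedMap hπ π e) := by
    simpa using h1.smul (-1)
  rcases hM.factorsThroughProjective hmax h2 with h | h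
  · exact Or.inl (eq_zero_of_inducedMap_factorsThroughProjective hπ hk hmax he h)
  · rw [← inducedMap_id hπ, ← inducedMap_sub] at h
    have he' : IsIdempotentElem (1 - e) := LinearMap.ext fun x => by
      have hx : e (e x) = e x := LinearMap.congr_fun he x
      change x - e x - e (x - e x) = x - e x
      rw [map_sub, hx, sub_self, sub_zero]
    have : 1 - e = 0 := eq_zero_of_inducedMap_factorsThroughProjective hπ hk hmax he' h
    exact Or.inr (sub_eq_zero.1 this).symm

theorem nonempty_linearEquiv_of_liftSubmodule {n' : ℕ} {M' : Type u} [AddCommGroup M']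
    [Module R M'] {π' : (Fin n' → R) →ₗ[R] M'} (hπ : Function.Surjective π)
    (hπ' : Function.Surjective π') (hmax : ∀ (φ : M →ₗ[R] R) (x : M), φ x ∈ maximalIdeal R)
    (hmax' : ∀ (φ : M' →ₗ[R] R) (x : M'), φ x ∈ maximalIdeal R)
    (f : liftSubmodule (LinearMap.ker π) ≃ₗ[R⟦X⟧] liftSubmodule (LinearMap.ker π')) :
    Nonempty (M ≃ₗ[R] M') := by
  have := Module.Finite.of_surjective π hπ
  have := Module.Finite.of_surjective π' hπ'
  have h1 := inducedMap_comp hπ hπ' f.toLinearMap f.symm.toLinearMap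
  have h2 := inducedMap_comp hπ' hπ f.symm.toLinearMap f.toLinearMap
  rw [LinearEquiv.symm_comp, inducedMap_id] at h1
  rw [LinearEquiv.comp_symm, inducedMap_id] at h2
  have s1 := surjective_of_id_sub_mem (h1.exists_lift_mem hmax)
  have s2 := surjective_of_id_sub_mem (h2.exists_lift_mem hmax')
  have i1 := OrzechProperty.injective_of_surjective_endomorphism _ s1
  rw [LinearMap.coe_comp] at i1 s2
  exact ⟨LinearEquiv.ofBijective (inducedMap hπ π' f.toLinearMap)
    ⟨i1.of_comp, s2.of_comp⟩⟩

end Local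

end PowerSeriesLattices

section PowerSeriesRegular

open PowerSeries RingTheory.Sequence

variable {R : Type u} [CommRing R]

theorem isWeaklyRegular_quotient_map_C {V W : Type u} [AddCommGroup V] [Module R⟦X⟧ V]
    [AddCommGroup W] [Module R W] (N : Submodule R⟦X⟧ V) (g : V →+ W)
    (hg : Function.Surjective g) (hker : ∀ x, x ∈ N ↔ g x = 0)
    (hsmul : ∀ (r : R) (x : V), g (C r • x) = r • g x) {rs : List R}
    (hrs : IsWeaklyRegular W rs) : IsWeaklyRegular (V ⧸ N) (rs.map C) := by
  have h : N.toAddSubgroup = g.ker := AddSubgroup.ext fun x => by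
    rw [AddMonoidHom.mem_ker, Submodule.mem_toAddSubgroup, hker]
  let e : (V ⧸ N) ≃+ W := (QuotientAddGroup.quotientAddEquivOfEq h).trans
    (QuotientAddGroup.quotientKerEquivOfSurjective g hg)
  refine (AddEquiv.isWeaklyRegular_congr (e := e) ?_).2 hrs
  refine List.forall₂_map_left_iff.2 (List.forall₂_same.2 fun r _ x => ?_)
  obtain ⟨v, rfl⟩ := Submodule.Quotient.mk_surjective N x
  exact hsmul r v

theorem isSMulRegular_X : IsSMulRegular R⟦X⟧ (X : R⟦X⟧) := fun _ _ h => X_mul_cancel h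

theorem isWeaklyRegular_X_cons {rs : List R} (hrs : IsWeaklyRegular R rs) :
    IsWeaklyRegular R⟦X⟧ (X :: rs.map C) := by
  refine IsWeaklyRegular.cons isSMulRegular_X ?_
  refine isWeaklyRegular_quotient_map_C _ (constantCoeff (R := R)).toAddMonoidHom
    (constantCoeff_surj) (fun x => ?_) (fun r x => ?_) hrs
  · rw [Submodule.mem_smul_pointwise_iff_exists]
    change _ ↔ constantCoeff x = 0
    rw [← X_dvd_iff]
    simp [dvd_def, eq_comm]
  · simp

variable [IsLocalRing R]

theorem mem_maximalIdeal_of_mem_map_C_append_X {rs : List R}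
    (hmem : ∀ r ∈ rs, r ∈ maximalIdeal R) :
    ∀ a ∈ rs.map (C (R := R)) ++ [X], a ∈ maximalIdeal R⟦X⟧ := by
  intro a ha
  rcases List.mem_append.1 ha with ha | ha
  · obtain ⟨r, hr, rfl⟩ := List.mem_map.1 ha
    exact mem_maximalIdeal_powerSeries.2 (by simpa using hmem r hr)
  · rw [List.mem_singleton.1 ha]
    exact X_mem_maximalIdeal

variable [IsNoetherianRing R]

theorem isRegular_map_C_append_X {rs : List R} (hmem : ∀ r ∈ rs, r ∈ maximalIdeal R)
    (hrs : IsWeaklyRegular R rs) :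
    IsRegular R⟦X⟧ (rs.map (C (R := R)) ++ [X]) := by
  have hmem' := mem_maximalIdeal_of_mem_map_C_append_X hmem
  rw [IsLocalRing.isRegular_iff_isWeaklyRegular_of_subset_maximalIdeal hmem']
  refine IsLocalRing.isWeaklyRegular_of_perm_of_subset_maximalIdeal
    (isWeaklyRegular_X_cons hrs) (List.perm_append_singleton _ _).symm fun a ha => ?_
  exact hmem' a ((List.perm_append_singleton _ _).mem_iff.2 ha)

theorem length_map_C_append_X {rs : List R} (hdim : (rs.length : WithBot ℕ∞) = ringKrullDim R) :
    ((rs.map (C (R := R)) ++ [X]).length : WithBot ℕ∞) = ringKrullDim R⟦X⟧ := by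
  have h : Ideal.span {(X : R⟦X⟧)} = RingHom.ker (constantCoeff (R := R)) := by
    ext a
    rw [Ideal.mem_span_singleton, RingHom.mem_ker, X_dvd_iff]
  have e : R⟦X⟧ ⧸ Ideal.span {(X : R⟦X⟧)} ≃+* R := (Ideal.quotEquivOfEq h).trans
    (RingHom.quotientKerEquivOfSurjective constantCoeff_surj)
  rw [← ringKrullDim_quotient_span_singleton_succ_eq_ringKrullDim isSMulRegular_X
    (X_mem_maximalIdeal (R := R)), ringKrullDim_eq_of_ringEquiv e, ← hdim]
  simp

theorem isWeaklyRegular_liftSubmodule {n : ℕ} {M : Type u} [AddCommGroup M] [Module R M]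
    {π : (Fin n → R) →ₗ[R] M} (hπ : Function.Surjective π) {rs : List R}
    (hmem : ∀ r ∈ rs, r ∈ maximalIdeal R) (hrs : IsWeaklyRegular R rs)
    (hM : IsWeaklyRegular M rs) :
    IsWeaklyRegular (liftSubmodule (LinearMap.ker π)) (rs.map (C (R := R)) ++ [X]) := by
  refine isWeaklyRegular_append_of_exact _ _ _ _ _ (liftSubmodule (LinearMap.ker π)).subtype
    (liftSubmodule (LinearMap.ker π)).mkQ (Submodule.subtype_injective _)
    (LinearMap.exact_subtype_mkQ _) (Submodule.mkQ_surjective _)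
    (isWeaklyRegular_fin (isRegular_map_C_append_X hmem hrs).toIsWeaklyRegular n) ?_
  refine isWeaklyRegular_quotient_map_C _ (π.comp (coeffs n 0)).toAddMonoidHom (fun x => ?_)
    (fun x => Iff.rfl) (fun r x => ?_) hM
  · obtain ⟨v, rfl⟩ := hπ x
    exact ⟨consts n v, congrArg π (coeffs_zero_consts v)⟩
  · change π (coeffs n 0 (C r • x)) = r • π (coeffs n 0 x)
    rw [coeffs_zero_smul, map_smul]
    simp

theorem IsTameLattice.liftSubmodule {n : ℕ} {M : Type u} [AddCommGroup M] [Module R M]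
    {π : (Fin n → R) →ₗ[R] M} (hπ : Function.Surjective π) {rs : List R}
    (hmem : ∀ r ∈ rs, r ∈ maximalIdeal R) (hrs : IsWeaklyRegular R rs)
    (hM : IsTameLattice rs M) :
    IsTameLattice (rs.map (C (R := R)) ++ [X]) (BT.liftSubmodule (LinearMap.ker π)) where
  finite := inferInstance
  exists_tame := hM.exists_tame.imp fun _ h => h.liftSubmodule hπ
  isWeaklyRegular := isWeaklyRegular_liftSubmodule hπ hmem hrs hM.isWeaklyRegular

end PowerSeriesRegular

section Transfer

open PowerSeries RingTheory.Sequence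

theorem IsTame.isTameLattice {S : Type u} [CommRing S] [IsLocalRing S] [IsNoetherianRing S]
    {rs : List S} (hrs : IsWeaklyRegular S rs) (hdim : (rs.length : WithBot ℕ∞) = ringKrullDim S)
    {c : ℕ} {Z : Type u} [AddCommGroup Z] [Module S Z] (hZ : IsTame S c Z)
    (hlat : IsLatticeC S Z) : IsTameLattice rs Z := by
  obtain ⟨hfin, ⟨ss, hss, hreg, hlen⟩, -⟩ := hlat
  have hl : ss.length = rs.length := by
    rw [← hdim] at hlen
    exact_mod_cast hlen
  have hext := ExtResidueVanishes.of_isRegular hss hreg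
  rw [hl] at hext
  obtain ⟨n, f, hf⟩ := Module.Finite.exists_fin' S Z
  refine ⟨hfin, ⟨c, hZ⟩, isWeaklyRegular_of_ext c rs (Fin n → S) Z (isWeaklyRegular_fin hrs n)
    (fun y hy => ?_) hext⟩
  obtain ⟨s, hs⟩ := (hZ y hy).exists_lift hf
  exact ⟨s, f, hs⟩

theorem exists_infMany_not_free {S : Type u} [CommRing S] [IsLocalRing S] {G : Type u}
    [AddCommGroup G] [Module S G] {t : ℕ} (h : InfManyIndecLatticesOfHLengthC S G t) :
    ∃ (F : ℕ → Type u) (_ : ∀ n, AddCommGroup (F n)) (_ : ∀ n, Module S (F n)),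
      (∀ n, IsLatticeC S (F n) ∧ IsIndecomposable S (F n) ∧
        hLengthC S (F n) G = (t : WithBot ℕ∞)) ∧
      (∀ n, IsEmpty (F n ≃ₗ[S] S)) ∧ ∀ m n : ℕ, m ≠ n → IsEmpty (F m ≃ₗ[S] F n) := by
  obtain ⟨F, i1, i2, hF, hne⟩ := h
  by_cases h0 : ∃ n0, Nonempty (F n0 ≃ₗ[S] S)
  · obtain ⟨n0, ⟨e⟩⟩ := h0
    refine ⟨fun n => F (n + n0 + 1), fun n => i1 _, fun n => i2 _, fun n => hF _,
      fun n => ⟨fun e' => ?_⟩, fun m n hmn => hne _ _ (by omega)⟩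
    exact (hne (n + n0 + 1) n0 (by omega)).false (e'.trans e.symm)
  · exact ⟨F, i1, i2, hF, fun n => ⟨fun e => h0 ⟨n, ⟨e⟩⟩⟩, hne⟩

theorem exists_infMany_of_length_le {S : Type u} [CommRing S] [IsLocalRing S] {G : Type u}
    [AddCommGroup G] [Module S G] {l : ℕ} {F : ℕ → Type u} [∀ n, AddCommGroup (F n)]
    [∀ n, Module S (F n)] (hF : ∀ n, IsLatticeC S (F n) ∧ IsIndecomposable S (F n))
    (hl : ∀ n, Module.length S (stableHom S S (F n) (F n × G)) ≤ l)
    (hne : ∀ m n : ℕ, m ≠ n → IsEmpty (F m ≃ₗ[S] F n)) :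
    ∃ (t n : ℕ), Module.length S (stableHom S S (F n) (F n × G)) = t ∧
      InfManyIndecLatticesOfHLengthC S G t := by
  have h : ∀ n, ∃ t : Fin (l + 1),
      Module.length S (stableHom S S (F n) (F n × G)) = (t : ℕ) := fun n => by
    obtain ⟨t, ht⟩ := ENat.ne_top_iff_exists.1 (ne_top_of_le_ne_top (ENat.natCast_ne_top l) (hl n))
    have hn := hl n
    rw [← ht] at hn
    exact ⟨⟨t, Nat.lt_succ_of_le (by exact_mod_cast hn)⟩, ht.symm⟩
  choose τ hτ using h
  obtain ⟨t, ht⟩ := Finite.exists_infinite_fiber τ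
  let j := Infinite.natEmbedding (τ ⁻¹' {t})
  have hj : ∀ n, Module.length S (stableHom S S (F (j n)) (F (j n) × G)) = ((t : ℕ) : ℕ∞) :=
    fun n => by rw [hτ, show τ (j n) = t from (j n).2]
  refine ⟨t, j 0, hj 0, fun n => F (j n), fun n => inferInstance, fun n => inferInstance,
    fun n => ⟨(hF _).1, (hF _).2, ?_⟩, fun m n hmn => hne _ _ fun h => hmn ?_⟩
  · rw [hLengthC_eq, hj]
    rfl
  · exact j.injective (Subtype.ext h)

variable {R : Type u} [CommRing R]

theorem exists_surjective_of_liftSubmodule {n ν : ℕ} {M : Type u} [AddCommGroup M] [Module R M]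
    {π : (Fin n → R) →ₗ[R] M} (hπ : Function.Surjective π)
    {q : (Fin ν → R⟦X⟧) →ₗ[R⟦X⟧] liftSubmodule (LinearMap.ker π)} (hq : Function.Surjective q) :
    ∃ g : (Fin ν → R) →ₗ[R] M, Function.Surjective g := by
  let f : (Fin ν → R⟦X⟧) →ₗ[R⟦X⟧] (Fin n → R⟦X⟧) := (liftSubmodule _).subtype.comp q
  refine ⟨π.comp ((coeffs n 1).comp ((f.restrictScalars R).comp (consts ν))), fun m => ?_⟩
  obtain ⟨w, rfl⟩ := hπ m
  obtain ⟨y, hy⟩ := hq (mulXMap _ (consts n w))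
  refine ⟨coeffs ν 0 y, ?_⟩
  have h1 : coeffs n 1 (f y) = w := by
    change coeffs n 1 (q y : Fin n → R⟦X⟧) = w
    rw [hy, coe_mulXMap, coeffs_succ_X_smul, coeffs_zero_consts]
  have h2 : π (coeffs n 0 (f (consts ν (coeffs ν 1 y)))) = 0 :=
    (q (consts ν (coeffs ν 1 y))).2
  change π (coeffs n 1 (f (consts ν (coeffs ν 0 y)))) = π w
  rw [← h1, coeffs_one_map f y, map_add, h2, add_zero]

variable [IsLocalRing R] [IsNoetherianRing R]

theorem exists_liftSubmodule_generators {rs : List R} (hrs : IsRegular R rs)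
    (hmem : ∀ r ∈ rs, r ∈ maximalIdeal R) (hdim : (rs.length : WithBot ℕ∞) = ringKrullDim R)
    (b : ℕ) :
    ∃ m : ℕ, ∀ (n : ℕ) (M : Type u) [AddCommGroup M] [Module R M] (π : (Fin n → R) →ₗ[R] M),
      n ≤ b → Function.Surjective π → IsWeaklyRegular M rs →
        ∃ f : (Fin m → R⟦X⟧) →ₗ[R⟦X⟧] liftSubmodule (LinearMap.ker π),
          Function.Surjective f := by
  obtain ⟨l, hl⟩ := exists_length_quotient_le hrs hmem hdim b
  refine ⟨l + b, fun n M _ _ π hn hπ hM => ?_⟩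
  obtain ⟨m, p, hp, hpk⟩ := exists_minimal_cover (S := R) (LinearMap.ker π)
  obtain ⟨g, hg⟩ := exists_surjective_of_le (f := LinearMap.id (R := R) (M := Fin n → R))
    Function.surjective_id hn
  have h1 := length_quotient_le_of_exact rs _ _ _ (LinearMap.ker π).subtype π
    (Submodule.subtype_injective _) (LinearMap.exact_subtype_ker_map π) hπ hM
  have h2 : (Ideal.ofList rs • ⊤ : Submodule R (LinearMap.ker π)) ≤ maximalIdeal R • ⊤ :=
    Submodule.smul_mono_left (Ideal.span_le.2 hmem)
  have h3 := Module.length_le_of_surjective (Submodule.factor h2) (Submodule.factor_surjective h2)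
  have hm : m ≤ l := by
    exact_mod_cast (((le_length_quotient hp hpk).trans h3).trans h1).trans (hl _ g hg)
  obtain ⟨f, hf⟩ := liftSubmodule_exists_surjective hp
  exact exists_surjective_of_le hf (by omega)

variable {G : Type u} [AddCommGroup G] [Module R G] {α : G →ₗ[R] ResidueField R}
  {G' : Type u} [AddCommGroup G'] [Module R⟦X⟧ G'] {α' : G' →ₗ[R⟦X⟧] ResidueField R⟦X⟧}
  {rs : List R}

theorem exists_length_stableHom_liftSubmodule_le (hrs : IsRegular R rs)
    (hmem : ∀ r ∈ rs, r ∈ maximalIdeal R) (hdim : (rs.length : WithBot ℕ∞) = ringKrullDim R)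
    (hG : IsResidueApprox R G α) (hG' : IsLatticeC R⟦X⟧ G') (b : ℕ) :
    ∃ l : ℕ, ∀ (n : ℕ) (M : Type u) [AddCommGroup M] [Module R M] (π : (Fin n → R) →ₗ[R] M),
      Function.Surjective π → LinearMap.ker π ≤ maximalIdeal R • ⊤ →
      (∀ (φ : M →ₗ[R] R) (x : M), φ x ∈ maximalIdeal R) → IsTameLattice rs M →
      Module.length R (stableHom R R M (M × G)) ≤ b →
        Module.length R⟦X⟧ (stableHom R⟦X⟧ R⟦X⟧ (liftSubmodule (LinearMap.ker π))
          (liftSubmodule (LinearMap.ker π) × G')) ≤ l := by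
  obtain ⟨m, hm⟩ := exists_liftSubmodule_generators hrs hmem hdim b
  obtain ⟨l, hl⟩ := exists_length_stableHom_le
    (isRegular_map_C_append_X hmem hrs.toIsWeaklyRegular)
    (mem_maximalIdeal_of_mem_map_C_append_X hmem) (length_map_C_append_X hdim) hG' b m
  refine ⟨l, fun n M _ _ π hπ hk hmax hM hb => ?_⟩
  have hn : n ≤ b := by
    exact_mod_cast ((hM.le_length_stableHom hrs hmem hdim hG hmax hπ hk).trans
      (length_stableHom_snd_le M M G)).trans hb
  obtain ⟨f, hf⟩ := hm n M π hn hπ hM.isWeaklyRegular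
  exact hl _ f hf ((IsTame.of_length_le ((length_stableHom_fst_le M M G).trans hb)).liftSubmodule
    hπ) (isWeaklyRegular_liftSubmodule hπ hmem hrs.toIsWeaklyRegular hM.isWeaklyRegular)

theorem exists_length_stableHom_le_of_liftSubmodule (hrs : IsRegular R rs)
    (hmem : ∀ r ∈ rs, r ∈ maximalIdeal R) (hdim : (rs.length : WithBot ℕ∞) = ringKrullDim R)
    (hG : IsLatticeC R G) (hG' : IsResidueApprox R⟦X⟧ G' α') (c : ℕ) :
    ∃ l : ℕ, ∀ (n : ℕ) (M : Type u) [AddCommGroup M] [Module R M] (π : (Fin n → R) →ₗ[R] M),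
      Function.Surjective π → LinearMap.ker π ≤ maximalIdeal R • ⊤ →
      (∀ (φ : M →ₗ[R] R) (x : M), φ x ∈ maximalIdeal R) → IsTameLattice rs M →
      Module.length R⟦X⟧ (stableHom R⟦X⟧ R⟦X⟧ (liftSubmodule (LinearMap.ker π))
          (liftSubmodule (LinearMap.ker π) × G')) ≤ c →
        Module.length R (stableHom R R M (M × G)) ≤ l := by
  obtain ⟨l, hl⟩ := exists_length_stableHom_le hrs hmem hdim hG c c
  refine ⟨l, fun n M _ _ π hπ hk hmax hM hc => ?_⟩
  obtain ⟨ν, q, hq, hqk⟩ := exists_minimal_cover (S := R⟦X⟧) (liftSubmodule (LinearMap.ker π))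
  have hν : ν ≤ c := by
    exact_mod_cast (((hM.liftSubmodule hπ hmem hrs.toIsWeaklyRegular).le_length_stableHom
      (isRegular_map_C_append_X hmem hrs.toIsWeaklyRegular)
      (mem_maximalIdeal_of_mem_map_C_append_X hmem) (length_map_C_append_X hdim) hG'
      (liftSubmodule_mem_maximalIdeal hπ hk hmax) hq hqk).trans
      (length_stableHom_snd_le _ _ G')).trans hc
  obtain ⟨g, hg⟩ := exists_surjective_of_liftSubmodule hπ hq
  obtain ⟨f, hf⟩ := exists_surjective_of_le hg hν
  exact hl M f hf (IsTame.of_liftSubmodule hπ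
    (IsTame.of_length_le ((length_stableHom_fst_le _ _ G').trans hc))) hM.isWeaklyRegular

end Transfer

/-- Suppose the commutative noetherian complete Cohen-Macaulay local ring `R`
with canonical module `ω` is an `R`-order, i.e. `ω` is locally free on the
punctured spectrum.  If `R` has strongly unbounded lattice type, then so does
the power series ring `R[[t]]`. -/
theorem powerSeries_strongly_unbounded
    (R : Type u) [CommRing R] [IsNoetherianRing R] [IsLocalRing R]
    [IsAdicComplete (maximalIdeal R) R]
    (hCM : IsMCM R R)
    (ω : Type u) [AddCommGroup ω] [Module R ω] (hω : IsCanonicalModule R ω)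
    (hωfree : ∀ (p : Ideal R) [p.IsPrime], p ≠ maximalIdeal R →
      Module.Free (Localization.AtPrime p) (LocalizedModule p.primeCompl ω))
    (G : Type u) [AddCommGroup G] [Module R G]
    (αG : G →ₗ[R] ResidueField R) (hG : IsResidueApprox R G αG)
    (hsu : StronglyUnboundedLatTypeC R G) :
    ∀ (G' : Type u) (_ : AddCommGroup G') (_ : Module (PowerSeries R) G')
      (α' : G' →ₗ[PowerSeries R] ResidueField (PowerSeries R)),
      IsResidueApprox (PowerSeries R) G' α' →
        StronglyUnboundedLatTypeC (PowerSeries R) G' := by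
  intro G' _ _ α' hG'
  obtain ⟨rs, hmem, hrs, hdim⟩ := hCM
  have hw := hrs.toIsWeaklyRegular
  obtain ⟨b, hb, hinf⟩ := hsu
  choose U hU using exists_length_stableHom_liftSubmodule_le hrs hmem hdim hG hG'.1
  choose L hL using exists_length_stableHom_le_of_liftSubmodule hrs hmem hdim hG.1 hG'
  have key : ∀ i, ∃ t, InfManyIndecLatticesOfHLengthC (PowerSeries R) G' t ∧ b i ≤ L t := by
    intro i
    obtain ⟨F, _, _, hF, hfree, hne⟩ := exists_infMany_not_free (hinf i)
    have hlen : ∀ n, Module.length R (stableHom R R (F n) (F n × G)) = b i := fun n => by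
      have := (hF n).2.2
      rw [hLengthC_eq] at this
      exact_mod_cast this
    have hfin : ∀ n, Module.Finite R (F n) := fun n => (hF n).1.1
    have hmax : ∀ n (φ : F n →ₗ[R] R) x, φ x ∈ maximalIdeal R := fun n =>
      (hF n).2.1.mem_maximalIdeal (hfree n)
    have htame : ∀ n, IsTameLattice rs (F n) := fun n =>
      (IsTame.of_length_le ((length_stableHom_fst_le _ _ G).trans (hlen n).le)).isTameLattice
        hw hdim (hF n).1
    choose d π hπ hk using fun n => exists_minimal_cover (S := R) (F n)
    have hind := fun n => liftSubmodule_isIndecomposable (hπ n) (hk n) (hmax n) (hF n).2.1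
    obtain ⟨t, n, ht, hinf'⟩ := exists_infMany_of_length_le (G := G') (l := U (b i))
      (F := fun n => liftSubmodule (LinearMap.ker (π n)))
      (fun n => ⟨have := (hind n).1
        ((htame n).liftSubmodule (hπ n) hmem hw).isLatticeC
          (mem_maximalIdeal_of_mem_map_C_append_X hmem) (length_map_C_append_X hdim), hind n⟩)
      (fun n => hU (b i) _ _ (π n) (hπ n) (hk n) (hmax n) (htame n) (hlen n).le)
      (fun m n hmn => ⟨fun e => not_isEmpty_iff.2 (nonempty_linearEquiv_of_liftSubmodule (hπ m)
        (hπ n) (hmax m) (hmax n) e) (hne m n hmn)⟩)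
    refine ⟨t, hinf', ?_⟩
    have := hL t _ _ (π n) (hπ n) (hk n) (hmax n) (htame n) ht.le
    rw [hlen] at this
    exact_mod_cast this
  have hT : {t | InfManyIndecLatticesOfHLengthC (PowerSeries R) G' t}.Infinite := by
    intro hfin
    obtain ⟨B, hB⟩ := (hfin.image L).bddAbove
    obtain ⟨t, ht, hbt⟩ := key (B + 1)
    have h1 : L t ≤ B := hB ⟨t, ht, rfl⟩
    have h2 : B + 1 ≤ b (B + 1) := hb.le_apply
    omega
  exact ⟨Nat.nth _, Nat.nth_strictMono hT, fun i => Nat.nth_mem_of_infinite hT i⟩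

end BT
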